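/- arXiv:0906.0763 — 3 statements merged into one kernel-verified Lean document; each statement's English description precedes it below -/
import Mathlib

section
/- Let Γ be a balanced two-dimensional simplicial complex and let W be a minimal vertex subset such that H̃_2(Γ[W]; k) ≠ 0 (i.e., H̃_2(Γ[W']; k) = 0 for all proper subsets W' ⊊ W). Then the number of 2-dimensional faces of Γ[W] is at least 2|W| − 4. -/
open Finset

/-- An (abstract) simplicial complex on vertex type `V`: a collection of finite
subsets of `V` (the faces) closed under taking subsets. -/
structure SC (V : Type*) where
  faces : Set (Finset V)
  down_closed : ∀ {F G : Finset V}, F ∈ faces → G ⊆ F → G ∈ faces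

namespace SC

variable {V : Type*} [LinearOrder V]

/-- The vertex set of a simplicial complex. -/
def vertexSet (K : SC V) : Set V := {v | {v} ∈ K.faces}

/-- The induced subcomplex `K[W]` on a set `W` of vertices. -/
def restrict (K : SC V) (W : Set V) : SC V where
  faces := {F | F ∈ K.faces ∧ ↑F ⊆ W}
  down_closed := fun hF hGF =>
    ⟨K.down_closed hF.1 hGF, Set.Subset.trans (Finset.coe_subset.mpr hGF) hF.2⟩

/-- The link `lk_K(F)` of a face `F`: all `G` disjoint from `F` with `F ∪ G ∈ K`. -/
def link (K : SC V) (F : Finset V) : SC V where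
  faces := {G | Disjoint F G ∧ F ∪ G ∈ K.faces}
  down_closed := fun hG hHG =>
    ⟨hG.1.mono_right (Finset.le_iff_subset.mpr hHG),
      K.down_closed hG.2 (Finset.union_subset_union_right hHG)⟩

/-- A complex is flag if every set all of whose subsets of cardinality at most 2
are faces is itself a face (equivalently, all minimal non-faces have two vertices). -/
def Flag (K : SC V) : Prop :=
  ∀ F : Finset V, (∀ G ⊆ F, G.card ≤ 2 → G ∈ K.faces) → F ∈ K.faces

/-- The faces of `K` with exactly `n` vertices (i.e. of dimension `n-1`). -/
def faceSet (K : SC V) (n : ℕ) : Set (Finset V) := {F | F ∈ K.faces ∧ F.card = n}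

variable (k : Type*) [Field k]

/-- Simplicial `(n-1)`-chains with coefficients in `k`: formal `k`-linear
combinations of faces with `n` vertices.  (`n = 0` corresponds to the empty face,
used for *reduced* homology.) -/
abbrev Chains (K : SC V) (n : ℕ) := (faceSet K n) →₀ k

/-- The boundary of a single face, with the usual signs determined by the
linear order on the vertices. -/
noncomputable def bdFace (K : SC V) (n : ℕ) (F : faceSet K (n + 1)) : Chains k K n :=
  ∑ v ∈ (F : Finset V).attach,
    ((-1 : k) ^ (((F : Finset V).filter (fun x => x < (v : V))).card)) •
      Finsupp.single (⟨(F : Finset V).erase v,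
        K.down_closed F.2.1 (Finset.erase_subset _ _),
        by rw [Finset.card_erase_of_mem v.2, F.2.2]; rfl⟩ : faceSet K n) 1

/-- The simplicial boundary map. -/
noncomputable def bd (K : SC V) (n : ℕ) : Chains k K (n + 1) →ₗ[k] Chains k K n :=
  Finsupp.lsum k fun F => LinearMap.toSpanSingleton k _ (bdFace k K n F)

/-- The reduced cycles in degree `n - 1` (chains supported on faces with `n` vertices). -/
noncomputable def cycles (K : SC V) : (n : ℕ) → Submodule k (Chains k K n)
  | 0 => ⊤
  | (m + 1) => LinearMap.ker (bd k K m)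

/-- The boundaries in degree `n - 1`. -/
noncomputable def boundaries (K : SC V) (n : ℕ) : Submodule k (Chains k K n) :=
  LinearMap.range (bd k K n)

/-- `HNonzero k K n` says that the reduced simplicial homology `H̃_{n-1}(K; k)`
is nonzero: some reduced cycle on faces with `n` vertices is not a boundary. -/
def HNonzero (K : SC V) (n : ℕ) : Prop := ¬ (cycles k K n ≤ boundaries k K n)

/-- The dimension of the reduced homology `H̃_{n-1}(K; k)` as a `k`-vector space
(for finite complexes): `dim (cycles) - dim (boundaries ∩ cycles)`. -/
noncomputable def homDim (K : SC V) (n : ℕ) : ℕ :=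
  Module.finrank k ↥(cycles k K n) -
    Module.finrank k ↥(boundaries k K n ⊓ cycles k K n)

/-- `girth k K p` is the `(p-1)`-girth `gr_{p-1}(K)` over the field `k`: the least
cardinality of a vertex set `W` such that `H̃_{p-1}(lk_K(F)[W]; k) ≠ 0` for some
face `F` of `K` (including the empty face), or `∞` if there is no such `W`. -/
noncomputable def girth (K : SC V) (p : ℕ) : ℕ∞ :=
  sInf ((fun W : Finset V => (W.card : ℕ∞)) ''
    {W : Finset V | ∃ F ∈ K.faces, HNonzero k ((K.link F).restrict ↑W) p})

/-- A non-returning walk of length `len` in the directed 1-skeleton of `K`: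
consecutive vertices span edges, and no three consecutive vertices return
(`v_i ≠ v_{i+2}`) or span a 2-face of `K`. -/
def IsNRWalk (K : SC V) (len : ℕ) (w : ℕ → V) : Prop :=
  (∀ i < len, w i ≠ w (i + 1) ∧ ({w i, w (i + 1)} : Finset V) ∈ K.faces) ∧
  (∀ i, i + 2 ≤ len → w i ≠ w (i + 2) ∧ ({w i, w (i + 1), w (i + 2)} : Finset V) ∉ K.faces)

end SC


theorem finrank_ker_le_one {k : Type*} [Field k] {m n : Type*} [Fintype m] [Fintype n]
    [DecidableEq n]
    (M : Matrix m n k) (w : n → k) (h : ∀ v, M.mulVec v = 0 → ∃ c : k, v = c • w) :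
    Fintype.card n ≤ M.rank + 1 := by
  have h1 := LinearMap.finrank_range_add_finrank_ker M.mulVecLin
  have h2 : LinearMap.ker M.mulVecLin ≤ Submodule.span k {w} := by
    intro v hv
    obtain ⟨c, hc⟩ := h v (by simpa using hv)
    exact Submodule.mem_span_singleton.2 ⟨c, hc.symm⟩
  have h3 := Submodule.finrank_mono h2
  have h4 := finrank_span_le_card (R := k) ({w} : Set (n → k))
  simp only [Module.finrank_fintype_fun_eq_card] at h1
  simp only [Set.toFinset_singleton, Finset.card_singleton] at h4
  unfold Matrix.rank
  omega

theorem core_count {k : Type*} [Field k] {X Y Z : Type*} [Fintype X] [Fintype Y] [Fintype Z]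
    [DecidableEq X] [DecidableEq Y] [DecidableEq Z]
    (T : X → Y → Z → k) (h0 : ∃ x y z, T x y z ≠ 0)
    (h1 : ∀ y z, ∑ x, T x y z = 0) (h2 : ∀ x z, ∑ y, T x y z = 0)
    (h3 : ∀ x y, ∑ z, T x y z = 0)
    (hm : ∀ (p : X → k) (q : Y → k) (r : Z → k),
      (∀ y z, ∑ x, (p x + q y + r z) * T x y z = 0) →
      (∀ x z, ∑ y, (p x + q y + r z) * T x y z = 0) →
      (∀ x y, ∑ z, (p x + q y + r z) * T x y z = 0) →
      ((∃ x, ∀ y z, (p x + q y + r z) * T x y z = 0) ∨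
       (∃ y, ∀ x z, (p x + q y + r z) * T x y z = 0) ∨
       (∃ z, ∀ x y, (p x + q y + r z) * T x y z = 0)) →
      ∀ x y z, (p x + q y + r z) * T x y z = 0) :
    2 * (Fintype.card X + Fintype.card Y + Fintype.card Z) ≤
      Set.ncard {t : X × Y × Z | T t.1 t.2.1 t.2.2 ≠ 0} + 4 := by
  classical
  obtain ⟨x0, y0, z0, hT0⟩ := h0
  have hone := hm (fun _ => 1) (fun _ => 0) (fun _ => 0)
    (by simpa using h1) (by simpa using h2) (by simpa using h3)
  simp only [add_zero, one_mul] at hone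
  have hX : ∀ x, ∃ y z, T x y z ≠ 0 := by
    intro x
    by_contra! hx
    exact hT0 (hone (Or.inl ⟨x, hx⟩) _ _ _)
  have hY : ∀ y, ∃ x z, T x y z ≠ 0 := by
    intro y
    by_contra! hx
    exact hT0 (hone (Or.inr (Or.inl ⟨y, hx⟩)) _ _ _)
  have hZ : ∀ z, ∃ x y, T x y z ≠ 0 := by
    intro z
    by_contra! hx
    exact hT0 (hone (Or.inr (Or.inr ⟨z, hx⟩)) _ _ _)
  let E := {e : X × Y // ∃ z, T e.1 e.2 z ≠ 0}
  let A : Matrix E Z k := fun e z => T e.1.1 e.1.2 z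
  let B : Matrix E (X ⊕ Y) k := fun e s =>
    Sum.elim (fun x => if e.1.1 = x then 1 else 0) (fun y => if e.1.2 = y then 1 else 0) s
  have hA : Fintype.card Z ≤ A.rank + 1 := by
    apply finrank_ker_le_one A (fun _ => 1)
    intro r hr
    have hr' : ∀ x y, ∑ z, T x y z * r z = 0 := by
      intro x y
      by_cases hE : ∃ z, T x y z ≠ 0
      · exact congrFun hr (⟨(x, y), hE⟩ : E)
      · push Not at hE
        simp [hE]
    have key := hm (fun _ => 0) (fun _ => 0) (fun z => r z - r z0)
      (by intro y z; simp only [zero_add, ← Finset.mul_sum, h1, mul_zero])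
      (by intro y z; simp only [zero_add, ← Finset.mul_sum, h2, mul_zero])
      (by
        intro x y
        simp only [zero_add, sub_mul, Finset.sum_sub_distrib, ← Finset.mul_sum, h3, mul_zero]
        rw [sub_zero, ← hr' x y]
        exact Finset.sum_congr rfl fun _ _ => mul_comm _ _)
      (Or.inr (Or.inr ⟨z0, by simp⟩))
    refine ⟨r z0, ?_⟩
    ext z
    obtain ⟨x, y, h⟩ := hZ z
    have := key x y z
    simp only [zero_add, mul_eq_zero, h, or_false] at this
    simp [sub_eq_zero.1 this]
  have hB : Fintype.card (X ⊕ Y) ≤ B.rank + 1 := by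
    apply finrank_ker_le_one B (Sum.elim (fun _ => 1) (fun _ => -1))
    intro v hv
    have hv' : ∀ x y z, T x y z ≠ 0 → v (Sum.inl x) = - v (Sum.inr y) := by
      intro x y z hT
      have := congrFun hv (⟨(x, y), z, hT⟩ : E)
      simp [Matrix.mulVec, dotProduct, B] at this
      exact eq_neg_of_add_eq_zero_left this
    have key := hm (fun x => v (Sum.inl x) - v (Sum.inl x0)) (fun _ => 0) (fun _ => 0)
      (by
        intro y z
        have : ∀ x, (v (Sum.inl x) - v (Sum.inl x0) + 0 + 0) * T x y z
            = (- v (Sum.inr y) - v (Sum.inl x0)) * T x y z := by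
          intro x
          by_cases hT : T x y z = 0
          · simp [hT]
          · rw [hv' x y z hT]; ring
        simp only [this, ← Finset.mul_sum, h1, mul_zero])
      (by intro y z; simp only [← Finset.mul_sum, h2, mul_zero])
      (by intro y z; simp only [← Finset.mul_sum, h3, mul_zero])
      (Or.inl ⟨x0, by simp⟩)
    have hc : ∀ x, v (Sum.inl x) = v (Sum.inl x0) := by
      intro x
      obtain ⟨y, z, h⟩ := hX x
      have := key x y z
      simp only [add_zero, mul_eq_zero, h, or_false] at this
      exact sub_eq_zero.1 this
    refine ⟨v (Sum.inl x0), ?_⟩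
    ext s
    rcases s with x | y
    · simp [hc x]
    · obtain ⟨x, z, h⟩ := hY y
      have := hv' x y z h
      rw [hc] at this
      simp [this]
  have hsum : ∀ (z : Z) (u : X × Y → k),
      ∑ e : E, u e.1 * T e.1.1 e.1.2 z = ∑ e : X × Y, u e * T e.1 e.2 z := by
    intro z u
    rw [← Finset.sum_subtype (Finset.univ.filter (fun e : X × Y => ∃ z, T e.1 e.2 z ≠ 0))
      (by simp) (fun e => u e * T e.1 e.2 z)]
    apply Finset.sum_subset (Finset.subset_univ _)
    intro e _ he
    simp only [Finset.mem_filter, Finset.mem_univ, true_and, not_exists, not_not] at he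
    rw [he z, mul_zero]
  have hBA : B.transpose * A = 0 := by
    ext s z
    rcases s with x | y
    · have := hsum z (fun e => if e.1 = x then 1 else 0)
      rw [Matrix.mul_apply]
      refine Eq.trans this ?_
      rw [ Fintype.sum_prod_type, Finset.sum_eq_single x]
      · simpa using h2 x z
      · intro b _ hb; simp [hb]
      · simp
    · have := hsum z (fun e => if e.2 = y then 1 else 0)
      rw [Matrix.mul_apply]
      refine Eq.trans this ?_
      rw [ Fintype.sum_prod_type_right, Finset.sum_eq_single y]
      · simpa using h1 y z
      · intro b _ hb; simp [hb]
      · simp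
  have hrank := Matrix.rank_add_rank_le_card_of_mul_eq_zero hBA
  rw [Matrix.rank_transpose] at hrank
  rw [Fintype.card_sum] at hB
  have hcard : 2 * Fintype.card E ≤ Set.ncard {t : X × Y × Z | T t.1 t.2.1 t.2.2 ≠ 0} := by
    rw [Set.ncard_eq_toFinset_card', mul_comm]
    set S := {t : X × Y × Z | T t.1 t.2.1 t.2.2 ≠ 0}.toFinset with hS
    have hmaps : ∀ t ∈ S, (t.1, t.2.1) ∈
        Finset.univ.filter (fun e : X × Y => ∃ z, T e.1 e.2 z ≠ 0) := by
      intro t ht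
      simp only [hS, Set.mem_toFinset, Set.mem_ofPred_eq] at ht
      simpa using ⟨_, ht⟩
    rw [Finset.card_eq_sum_card_fiberwise hmaps]
    have : Fintype.card E = (Finset.univ.filter (fun e : X × Y => ∃ z, T e.1 e.2 z ≠ 0)).card :=
      Fintype.card_subtype _
    rw [this, ← smul_eq_mul]
    apply Finset.card_nsmul_le_sum
    rintro ⟨x, y⟩ he
    simp only [Finset.mem_filter, Finset.mem_univ, true_and] at he
    obtain ⟨z, hz⟩ := he
    have : ∃ z', z' ≠ z ∧ T x y z' ≠ 0 := by
      by_contra! hcon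
      apply hz
      rw [← h3 x y, Finset.sum_eq_single z (fun b _ hb => hcon b hb) (by simp)]
    obtain ⟨z', hne, hz'⟩ := this
    rw [Nat.succ_le_iff, Finset.one_lt_card]
    exact ⟨(x, y, z), by simp [hS, hz], (x, y, z'), by simp [hS, hz'], by simp [hne.symm]⟩
  omega

/-- A function on finsets encoding a 2-cycle of `Γ[W]`. -/
def IsCyc {V : Type*} [LinearOrder V] {k : Type*} [Field k] (Γ : SC V) (W : Finset V)
    (g : Finset V → k) : Prop :=
  (∀ F, g F ≠ 0 → F ∈ Γ.faces ∧ F.card = 3 ∧ F ⊆ W) ∧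
  ∀ e : Finset V, e.card = 2 →
    ∑ v ∈ W \ e, (-1 : k) ^ (e.filter (fun x => x < v)).card * g (insert v e) = 0

open Classical in
/-- Extension by zero. -/
noncomputable def extc {V : Type*} [LinearOrder V] {k : Type*} [Field k] (K : SC V) {n : ℕ}
    (c : SC.Chains k K n) (F : Finset V) : k :=
  if h : F ∈ SC.faceSet K n then c ⟨F, h⟩ else 0

theorem bd_apply_extc {V : Type*} [LinearOrder V] {k : Type*} [Field k] (Γ : SC V) (W : Finset V)
    (c : SC.Chains k (Γ.restrict ↑W) 3) (e : SC.faceSet (Γ.restrict ↑W) 2) :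
    SC.bd k (Γ.restrict ↑W) 2 c e =
    ∑ v ∈ W \ e.1, (-1 : k) ^ (e.1.filter (fun x => x < v)).card *
      extc (Γ.restrict ↑W) c (insert v e.1) := by
  classical
  induction c using Finsupp.induction_linear with
  | zero => simp [extc]
  | add f g hf hg =>
    have : ∀ F, extc (Γ.restrict ↑W) (f + g) F =
        extc (Γ.restrict ↑W) f F + extc (Γ.restrict ↑W) g F := by
      intro F; unfold extc; split_ifs <;> simp
    simp only [map_add, Finsupp.add_apply, hf, hg, this, mul_add, Finset.sum_add_distrib]
  | single F a =>
    have hx : ∀ G, extc (Γ.restrict ↑W) (Finsupp.single F a) G = if G = F.1 then a else 0 := by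
      intro G
      unfold extc
      by_cases hG : G = F.1
      · subst hG; simp
      · rw [if_neg hG]
        split_ifs
        · rw [Finsupp.single_apply, if_neg]
          rintro rfl; exact hG rfl
        · rfl
    simp only [hx]
    simp only [SC.bd, Finsupp.lsum_single, LinearMap.toSpanSingleton_apply, SC.bdFace,
      Finsupp.smul_apply, Finsupp.finset_sum_apply, Finsupp.single_apply, Subtype.ext_iff,
      smul_eq_mul]
    have h1 := Finset.sum_attach F.1 (fun v => (-1 : k) ^ (F.1.filter (fun x => x < v)).card *
      if F.1.erase v = e.1 then 1 else 0)
    rw [h1, Finset.mul_sum]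
    simp only [mul_ite, mul_one, mul_zero]
    rw [← Finset.sum_filter, ← Finset.sum_filter]
    have hFW : F.1 ⊆ W := by exact_mod_cast F.2.1.2
    have hset : F.1.filter (fun v => F.1.erase v = e.1) =
        (W \ e.1).filter (fun v => insert v e.1 = F.1) := by
      ext v
      simp only [Finset.mem_filter, Finset.mem_sdiff]
      constructor
      · rintro ⟨hv, he⟩
        rw [← he]
        exact ⟨⟨hFW hv, by simp⟩, Finset.insert_erase hv⟩
      · rintro ⟨⟨hv, he⟩, hi⟩
        rw [← hi]
        exact ⟨by simp, Finset.erase_insert he⟩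
    rw [hset]
    apply Finset.sum_congr rfl
    intro v hv
    rw [Finset.mem_filter] at hv
    rw [← hv.2, Finset.filter_insert, if_neg (lt_irrefl v), mul_comm]

theorem hnonzero_iff {V : Type*} [LinearOrder V] (k : Type*) [Field k] (Γ : SC V)
    (hdim : ∀ F ∈ Γ.faces, F.card ≤ 3) (W : Finset V) :
    SC.HNonzero k (Γ.restrict ↑W) 3 ↔ ∃ g : Finset V → k, g ≠ 0 ∧ IsCyc Γ W g := by
  classical
  have hb : SC.boundaries k (Γ.restrict ↑W) 3 = ⊥ := by
    have : IsEmpty (SC.faceSet (Γ.restrict ↑W) (3 + 1)) := by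
      constructor
      rintro ⟨F, hF⟩
      have := hdim F hF.1.1
      have := hF.2
      omega
    rw [SC.boundaries, LinearMap.range_eq_bot]
    ext x
    exact isEmptyElim x
  unfold SC.HNonzero
  rw [hb, le_bot_iff, Submodule.eq_bot_iff]
  push Not
  constructor
  · rintro ⟨c, hc, hne⟩
    refine ⟨extc _ c, ?_, ?_, ?_⟩
    · intro h
      apply hne
      ext F
      have := congrFun h F.1
      simpa [extc] using this
    · intro F hF
      unfold extc at hF
      split_ifs at hF with h
      · exact ⟨h.1.1, h.2, by exact_mod_cast h.1.2⟩
      · exact absurd rfl hF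
    · intro e he
      by_cases hf : e ∈ SC.faceSet (Γ.restrict ↑W) 2
      · rw [← bd_apply_extc Γ W c ⟨e, hf⟩]
        have : SC.bd k (Γ.restrict ↑W) 2 c = 0 := hc
        rw [this]; rfl
      · apply Finset.sum_eq_zero
        intro v hv
        unfold extc
        rw [dif_neg, mul_zero]
        intro h
        exact hf ⟨(Γ.restrict ↑W).down_closed h.1 (Finset.subset_insert _ _), he⟩
  · rintro ⟨g, hne, hg⟩
    have hfin : (SC.faceSet (Γ.restrict ↑W) 3).Finite := by
      apply (W.powerset.finite_toSet).subset
      intro F hF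
      have : F ⊆ W := by exact_mod_cast hF.1.2
      simpa using this
    have := hfin.fintype
    let c : SC.Chains k (Γ.restrict ↑W) 3 := Finsupp.equivFunOnFinite.symm (fun F => g F.1)
    have hx : extc _ c = g := by
      ext F
      unfold extc
      split_ifs with h
      · simp [c]
      · by_contra hF
        obtain ⟨h1, h2, h3⟩ := hg.1 F (Ne.symm hF)
        exact h ⟨⟨h1, by exact_mod_cast h3⟩, h2⟩
    refine ⟨c, ?_, ?_⟩
    · change SC.bd k (Γ.restrict ↑W) 2 c = 0
      ext e
      rw [bd_apply_extc, hx, hg.2 e.1 e.2.2]; rfl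
    · intro h
      apply hne
      rw [← hx, h]
      ext F
      simp [extc]


/-- Sign of a pair. -/
def sg {V : Type*} [LinearOrder V] (k : Type*) [Field k] (a b : V) : k := if a < b then -1 else 1

theorem sg_swap {V : Type*} [LinearOrder V] (k : Type*) [Field k] {a b : V} (h : a ≠ b) :
    sg k b a = - sg k a b := by
  unfold sg
  rcases lt_or_gt_of_ne h with h | h
  · simp [h, h.not_gt]
  · simp [h, h.not_gt]

theorem sg_ne {V : Type*} [LinearOrder V] (k : Type*) [Field k] (a b : V) : sg k a b ≠ 0 := by
  unfold sg
  split_ifs <;> simp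

theorem sign_pair {V : Type*} [LinearOrder V] (k : Type*) [Field k] {a b : V} (h : a ≠ b) (v : V) :
    (-1 : k) ^ (({a, b} : Finset V).filter (fun x => x < v)).card = sg k a v * sg k b v := by
  unfold sg
  rw [Finset.filter_insert, Finset.filter_singleton]
  split_ifs <;> simp [h]

/-- Balanced on `W` with colour classes `P`, `Q`, `R`. -/
structure Bal {V : Type*} [LinearOrder V] (Γ : SC V) (W P Q R : Finset V) : Prop where
  pq : Disjoint P Q
  pr : Disjoint P R
  qr : Disjoint Q R
  un : P ∪ Q ∪ R = W
  cp : ∀ F ∈ Γ.faces, (F ∩ P).card ≤ 1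
  cq : ∀ F ∈ Γ.faces, (F ∩ Q).card ≤ 1
  cr : ∀ F ∈ Γ.faces, (F ∩ R).card ≤ 1

theorem Bal.rot {V : Type*} [LinearOrder V] {Γ : SC V} {W P Q R : Finset V} (h : Bal Γ W P Q R) :
    Bal Γ W Q R P :=
  ⟨h.qr, h.pq.symm, h.pr.symm, by rw [← h.un]; ext; simp; tauto, h.cq, h.cr, h.cp⟩

theorem Bal.swap {V : Type*} [LinearOrder V] {Γ : SC V} {W P Q R : Finset V} (h : Bal Γ W P Q R) :
    Bal Γ W P R Q :=
  ⟨h.pr, h.pq, h.qr.symm, by rw [← h.un]; ext; simp; tauto, h.cp, h.cr, h.cq⟩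

theorem eq_of_card_inter {V : Type*} [DecidableEq V] {F P : Finset V} (h : (F ∩ P).card ≤ 1)
    {a b : V} (ha : a ∈ F) (hb : b ∈ F) (ha' : a ∈ P) (hb' : b ∈ P) : a = b :=
  Finset.card_le_one.1 h a (by simp [ha, ha']) b (by simp [hb, hb'])

theorem Bal.sum_eq {V : Type*} [LinearOrder V] {k : Type*} [Field k] {Γ : SC V}
    {W P Q R : Finset V} (h : Bal Γ W P Q R) (g : Finset V → k)
    (hg : ∀ F, g F ≠ 0 → F ∈ Γ.faces ∧ F.card = 3 ∧ F ⊆ W) {p q : V} (hp : p ∈ P) (hq : q ∈ Q) :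
    ∑ v ∈ W \ {p, q}, (-1 : k) ^ (({p, q} : Finset V).filter (fun x => x < v)).card *
      g (insert v {p, q}) = ∑ r ∈ R, sg k p r * sg k q r * g {p, q, r} := by
  have hpq : p ≠ q := Finset.disjoint_left.1 h.pq |> fun h' e => h' hp (e ▸ hq)
  have hins : ∀ v, insert v ({p, q} : Finset V) = {p, q, v} := by
    intro v; ext; simp; tauto
  simp only [sign_pair k hpq, hins]
  symm
  apply Finset.sum_subset
  · intro r hr
    rw [Finset.mem_sdiff, ← h.un]
    refine ⟨by simp [hr], ?_⟩
    simp only [Finset.mem_insert, Finset.mem_singleton, not_or]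
    exact ⟨fun e => Finset.disjoint_left.1 h.pr hp (e ▸ hr),
      fun e => Finset.disjoint_left.1 h.qr hq (e ▸ hr)⟩
  · intro v hv hvR
    have hz : g {p, q, v} = 0 := by
      by_contra hne
      obtain ⟨hF, -, -⟩ := hg _ hne
      rw [Finset.mem_sdiff, ← h.un] at hv
      simp only [Finset.mem_union, Finset.mem_insert, Finset.mem_singleton, not_or] at hv
      rcases hv.1 with (hvP | hvQ) | hvR'
      · exact hv.2.1 (eq_of_card_inter (h.cp _ hF) (by simp) (by simp) hvP hp)
      · exact hv.2.2 (eq_of_card_inter (h.cq _ hF) (by simp) (by simp) hvQ hq)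
      · exact hvR hvR'
    rw [hz, mul_zero]

/-- The signed tensor. -/
def tens {V : Type*} [LinearOrder V] {k : Type*} [Field k] (g : Finset V → k) (x y z : V) : k :=
  sg k x y * sg k x z * sg k y z * g {x, y, z}

theorem Bal.isCyc_iff {V : Type*} [LinearOrder V] {k : Type*} [Field k] {Γ : SC V}
    {W P Q R : Finset V} (h : Bal Γ W P Q R) (g : Finset V → k)
    (hg : ∀ F, g F ≠ 0 → F ∈ Γ.faces ∧ F.card = 3 ∧ F ⊆ W) :
    IsCyc Γ W g ↔ (∀ y ∈ Q, ∀ z ∈ R, ∑ x ∈ P, tens g x y z = 0) ∧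
      (∀ x ∈ P, ∀ z ∈ R, ∑ y ∈ Q, tens g x y z = 0) ∧
      (∀ x ∈ P, ∀ y ∈ Q, ∑ z ∈ R, tens g x y z = 0) := by
  have e1 : ∀ y ∈ Q, ∀ z ∈ R, ∑ x ∈ P, tens g x y z =
      sg k y z * ∑ x ∈ P, sg k y x * sg k z x * g {y, z, x} := by
    intro y hy z hz
    rw [Finset.mul_sum]
    apply Finset.sum_congr rfl
    intro x hx
    have a1 : x ≠ y := fun e => Finset.disjoint_left.1 h.pq hx (e ▸ hy)
    have a2 : x ≠ z := fun e => Finset.disjoint_left.1 h.pr hx (e ▸ hz)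
    have : ({y, z, x} : Finset V) = {x, y, z} := by ext; simp; tauto
    rw [tens, this, sg_swap k a1, sg_swap k a2]
    ring
  have e2 : ∀ x ∈ P, ∀ z ∈ R, ∑ y ∈ Q, tens g x y z =
      - sg k x z * ∑ y ∈ Q, sg k x y * sg k z y * g {x, z, y} := by
    intro x hx z hz
    rw [Finset.mul_sum]
    apply Finset.sum_congr rfl
    intro y hy
    have a2 : y ≠ z := fun e => Finset.disjoint_left.1 h.qr hy (e ▸ hz)
    have : ({x, z, y} : Finset V) = {x, y, z} := by ext; simp; tauto
    rw [tens, this, sg_swap k a2]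
    ring
  have e3 : ∀ x ∈ P, ∀ y ∈ Q, ∑ z ∈ R, tens g x y z =
      sg k x y * ∑ z ∈ R, sg k x z * sg k y z * g {x, y, z} := by
    intro x hx y hy
    rw [Finset.mul_sum]
    apply Finset.sum_congr rfl
    intro z hz
    rw [tens]
    ring
  constructor
  · intro hc
    refine ⟨fun y hy z hz => ?_, fun x hx z hz => ?_, fun x hx y hy => ?_⟩
    · rw [e1 y hy z hz, ← h.rot.sum_eq g hg hy hz, hc.2, mul_zero]
      exact Finset.card_pair fun e => Finset.disjoint_left.1 h.qr hy (e ▸ hz)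
    · rw [e2 x hx z hz, ← h.swap.sum_eq g hg hx hz, hc.2, mul_zero]
      exact Finset.card_pair fun e => Finset.disjoint_left.1 h.pr hx (e ▸ hz)
    · rw [e3 x hx y hy, ← h.sum_eq g hg hx hy, hc.2, mul_zero]
      exact Finset.card_pair fun e => Finset.disjoint_left.1 h.pq hx (e ▸ hy)
  · rintro ⟨h1, h2, h3⟩
    refine ⟨hg, fun e he => ?_⟩
    have k1 : ∀ y ∈ Q, ∀ z ∈ R, ∑ x ∈ P, sg k y x * sg k z x * g {y, z, x} = 0 := by
      intro y hy z hz
      have := h1 y hy z hz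
      rw [e1 y hy z hz] at this
      exact (mul_eq_zero.1 this).resolve_left (sg_ne k _ _)
    have k2 : ∀ x ∈ P, ∀ z ∈ R, ∑ y ∈ Q, sg k x y * sg k z y * g {x, z, y} = 0 := by
      intro y hy z hz
      have := h2 y hy z hz
      rw [e2 y hy z hz] at this
      exact (mul_eq_zero.1 this).resolve_left (neg_ne_zero.2 (sg_ne k _ _))
    have k3 : ∀ x ∈ P, ∀ y ∈ Q, ∑ z ∈ R, sg k x z * sg k y z * g {x, y, z} = 0 := by
      intro y hy z hz
      have := h3 y hy z hz
      rw [e3 y hy z hz] at this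
      exact (mul_eq_zero.1 this).resolve_left (sg_ne k _ _)
    by_contra hne
    obtain ⟨v, hv, hvne⟩ := Finset.exists_ne_zero_of_sum_ne_zero hne
    obtain ⟨hF, -, hFW⟩ := hg _ (right_ne_zero_of_mul hvne)
    obtain ⟨a, b, hab, rfl⟩ := Finset.card_eq_two.1 he
    have haW : a ∈ P ∪ Q ∪ R := h.un ▸ hFW (by simp)
    have hbW : b ∈ P ∪ Q ∪ R := h.un ▸ hFW (by simp)
    simp only [Finset.mem_union] at haW hbW
    rcases haW with (ha | ha) | ha <;> rcases hbW with (hb | hb) | hb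
    · exact hab (eq_of_card_inter (h.cp _ hF) (by simp) (by simp) ha hb)
    · exact hne (by rw [h.sum_eq g hg ha hb, k3 a ha b hb])
    · exact hne (by rw [h.swap.sum_eq g hg ha hb, k2 a ha b hb])
    · exact hne (by rw [Finset.pair_comm, h.sum_eq g hg hb ha, k3 b hb a ha])
    · exact hab (eq_of_card_inter (h.cq _ hF) (by simp) (by simp) ha hb)
    · exact hne (by rw [h.rot.sum_eq g hg ha hb, k1 a ha b hb])
    · exact hne (by rw [Finset.pair_comm, h.swap.sum_eq g hg hb ha, k2 b hb a ha])
    · exact hne (by rw [Finset.pair_comm, h.rot.sum_eq g hg hb ha, k1 b hb a ha])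
    · exact hab (eq_of_card_inter (h.cr _ hF) (by simp) (by simp) ha hb)

theorem isCyc_erase {V : Type*} [LinearOrder V] {k : Type*} [Field k] {Γ : SC V}
    {W : Finset V} {g : Finset V → k} (hg : IsCyc Γ W g) {v : V}
    (hv : ∀ F, v ∈ F → g F = 0) : IsCyc Γ (W.erase v) g := by
  refine ⟨fun F hF => ?_, fun e he => ?_⟩
  · obtain ⟨h1, h2, h3⟩ := hg.1 F hF
    exact ⟨h1, h2, Finset.subset_erase.2 ⟨h3, fun hvF => hF (hv F hvF)⟩⟩
  · rw [← hg.2 e he]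
    apply Finset.sum_subset (Finset.sdiff_subset_sdiff (Finset.erase_subset _ _) le_rfl)
    intro w hw hw'
    have : w = v := by
      simp only [Finset.mem_sdiff, Finset.mem_erase] at hw hw'
      tauto
    subst this
    rw [hv _ (by simp), mul_zero]

/-- A nonzero value of the tensor scaled by `m` forces a face. -/
theorem Bal.exists_triple {V : Type*} [LinearOrder V] {Γ : SC V}
    {W P Q R : Finset V} (h : Bal Γ W P Q R) {F : Finset V} (hF : F ∈ Γ.faces) (h3 : F.card = 3)
    (hW : F ⊆ W) : ∃ x ∈ P, ∃ y ∈ Q, ∃ z ∈ R, F = {x, y, z} := by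
  have hu : F = (F ∩ P) ∪ (F ∩ Q) ∪ (F ∩ R) := by
    rw [← Finset.inter_union_distrib_left, ← Finset.inter_union_distrib_left, h.un,
      Finset.inter_eq_left.2 hW]
  have hc := congrArg Finset.card hu
  have u1 := Finset.card_union_le ((F ∩ P) ∪ (F ∩ Q)) (F ∩ R)
  have u2 := Finset.card_union_le (F ∩ P) (F ∩ Q)
  have cp := h.cp F hF
  have cq := h.cq F hF
  have cr := h.cr F hF
  obtain ⟨x, hx⟩ := Finset.card_eq_one.1 (show (F ∩ P).card = 1 by omega)
  obtain ⟨y, hy⟩ := Finset.card_eq_one.1 (show (F ∩ Q).card = 1 by omega)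
  obtain ⟨z, hz⟩ := Finset.card_eq_one.1 (show (F ∩ R).card = 1 by omega)
  refine ⟨x, ?_, y, ?_, z, ?_, ?_⟩
  · exact (Finset.mem_inter.1 (hx ▸ Finset.mem_singleton_self x)).2
  · exact (Finset.mem_inter.1 (hy ▸ Finset.mem_singleton_self y)).2
  · exact (Finset.mem_inter.1 (hz ▸ Finset.mem_singleton_self z)).2
  · rw [hx, hy, hz] at hu
    rw [hu]
    ext; simp [or_assoc]

theorem Bal.count {V : Type*} [LinearOrder V] {k : Type*} [Field k] {Γ : SC V}
    {W P Q R : Finset V} (h : Bal Γ W P Q R) (g : Finset V → k) (hg : IsCyc Γ W g) (hg0 : g ≠ 0)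
    (hmin : ∀ g' : Finset V → k, IsCyc Γ W g' → ∀ v ∈ W, (∀ F, v ∈ F → g' F = 0) → g' = 0) :
    2 * W.card ≤ Set.ncard {F | F ∈ Γ.faces ∧ F.card = 3 ∧ ↑F ⊆ (↑W : Set V)} + 4 := by
  classical
  have hcardW : W.card = P.card + Q.card + R.card := by
    rw [← h.un, Finset.card_union_of_disjoint, Finset.card_union_of_disjoint h.pq]
    exact Finset.disjoint_union_left.2 ⟨h.pr, h.qr⟩
  have sgnz : ∀ x y z : V, sg k x y * sg k x z * sg k y z ≠ 0 := fun x y z =>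
    mul_ne_zero (mul_ne_zero (sg_ne k _ _) (sg_ne k _ _)) (sg_ne k _ _)
  have hxy : ∀ {x y}, x ∈ P → y ∈ Q → x ≠ y := fun hx hy e =>
    Finset.disjoint_left.1 h.pq hx (e ▸ hy)
  have hxz : ∀ {x y}, x ∈ P → y ∈ R → x ≠ y := fun hx hy e =>
    Finset.disjoint_left.1 h.pr hx (e ▸ hy)
  have hyz : ∀ {x y}, x ∈ Q → y ∈ R → x ≠ y := fun hx hy e =>
    Finset.disjoint_left.1 h.qr hx (e ▸ hy)
  let T : P → Q → R → k := fun x y z => tens g x.1 y.1 z.1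
  obtain ⟨c1, c2, c3⟩ := (h.isCyc_iff g hg.1).1 hg
  have hcore := core_count T ?_ ?_ ?_ ?_ ?_
  · simp only [Fintype.card_coe] at hcore
    rw [hcardW]
    refine hcore.trans (Nat.add_le_add_right ?_ 4)
    have hfin : {F | F ∈ Γ.faces ∧ F.card = 3 ∧ ↑F ⊆ (↑W : Set V)}.Finite := by
      apply (W.powerset.finite_toSet).subset
      intro F hF
      have : F ⊆ W := by exact_mod_cast hF.2.2
      simpa using this
    refine Set.ncard_le_ncard_of_injOn (fun t : P × Q × R => ({t.1.1, t.2.1.1, t.2.2.1} : Finset V))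
      ?_ ?_ hfin
    · rintro ⟨x, y, z⟩ ht
      have ht' : g {x.1, y.1, z.1} ≠ 0 := right_ne_zero_of_mul ht
      obtain ⟨a, b, c⟩ := hg.1 _ ht'
      exact ⟨a, b, Finset.coe_subset.2 c⟩
    · rintro ⟨x, y, z⟩ ht ⟨x', y', z'⟩ ht' he
      have ht2 : g {x.1, y.1, z.1} ≠ 0 := right_ne_zero_of_mul ht
      obtain ⟨a, -, -⟩ := hg.1 _ ht2
      have he' : ({x.1, y.1, z.1} : Finset V) = {x'.1, y'.1, z'.1} := he
      have r1 := eq_of_card_inter (h.cp _ a) (a := x.1) (b := x'.1) (by simp)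
        (by rw [he']; simp) x.2 x'.2
      have r2 := eq_of_card_inter (h.cq _ a) (a := y.1) (b := y'.1) (by simp)
        (by rw [he']; simp) y.2 y'.2
      have r3 := eq_of_card_inter (h.cr _ a) (a := z.1) (b := z'.1) (by simp)
        (by rw [he']; simp) z.2 z'.2
      simp [Subtype.ext_iff, r1, r2, r3]
  · obtain ⟨F, hF⟩ := Function.ne_iff.1 hg0
    obtain ⟨a, b, c⟩ := hg.1 F hF
    obtain ⟨x, hx, y, hy, z, hz, rfl⟩ := h.exists_triple a b c
    exact ⟨⟨x, hx⟩, ⟨y, hy⟩, ⟨z, hz⟩, mul_ne_zero (sgnz _ _ _) hF⟩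
  · intro y z
    rw [← c1 y.1 y.2 z.1 z.2]
    exact Finset.sum_coe_sort P (fun x => tens g x y.1 z.1)
  · intro x z
    rw [← c2 x.1 x.2 z.1 z.2]
    exact Finset.sum_coe_sort Q (fun y => tens g x.1 y z.1)
  · intro x y
    rw [← c3 x.1 x.2 y.1 y.2]
    exact Finset.sum_coe_sort R (fun z => tens g x.1 y.1 z)
  · intro p q r m1 m2 m3 hex
    let φ : V → k := fun v => if hp : v ∈ P then p ⟨v, hp⟩ else if hq : v ∈ Q then q ⟨v, hq⟩ else
      if hr : v ∈ R then r ⟨v, hr⟩ else 0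
    have φp : ∀ x : P, φ x.1 = p x := by
      intro x; simp [φ]
    have φq : ∀ y : Q, φ y.1 = q y := by
      intro y
      have : y.1 ∉ P := fun hh => hxy hh y.2 rfl
      simp [φ, this]
    have φr : ∀ z : R, φ z.1 = r z := by
      intro z
      have h1 : z.1 ∉ P := fun hh => hxz hh z.2 rfl
      have h2 : z.1 ∉ Q := fun hh => hyz hh z.2 rfl
      simp [φ, h1, h2]
    let g' : Finset V → k := fun F => (∑ v ∈ F, φ v) * g F
    have hT' : ∀ (x : P) (y : Q) (z : R), tens g' x.1 y.1 z.1 = (p x + q y + r z) * T x y z := by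
      intro x y z
      have hs : ∑ v ∈ ({x.1, y.1, z.1} : Finset V), φ v = p x + q y + r z := by
        rw [Finset.sum_insert, Finset.sum_pair (hyz y.2 z.2), φp, φq, φr, add_assoc]
        simp [hxy x.2 y.2, hxz x.2 z.2]
      simp only [tens, g', T, hs]
      ring
    have hsupp : ∀ F, g' F ≠ 0 → F ∈ Γ.faces ∧ F.card = 3 ∧ F ⊆ W := fun F hF =>
      hg.1 F (right_ne_zero_of_mul hF)
    have hcyc : IsCyc Γ W g' := by
      rw [h.isCyc_iff g' hsupp]
      refine ⟨fun y hy z hz => ?_, fun x hx z hz => ?_, fun x hx y hy => ?_⟩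
      · rw [← m1 ⟨y, hy⟩ ⟨z, hz⟩, ← Finset.sum_coe_sort P]
        exact Finset.sum_congr rfl fun x _ => hT' x ⟨y, hy⟩ ⟨z, hz⟩
      · rw [← m2 ⟨x, hx⟩ ⟨z, hz⟩, ← Finset.sum_coe_sort Q]
        exact Finset.sum_congr rfl fun y _ => hT' ⟨x, hx⟩ y ⟨z, hz⟩
      · rw [← m3 ⟨x, hx⟩ ⟨y, hy⟩, ← Finset.sum_coe_sort R]
        exact Finset.sum_congr rfl fun z _ => hT' ⟨x, hx⟩ ⟨y, hy⟩ z
    have hex' : ∃ v ∈ W, ∀ F, v ∈ F → g' F = 0 := by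
      have aux : ∀ v ∈ W, (∀ (x : P) (y : Q) (z : R), v ∈ ({x.1, y.1, z.1} : Finset V) →
          (p x + q y + r z) * T x y z = 0) → ∃ v ∈ W, ∀ F, v ∈ F → g' F = 0 := by
        intro v hv hh
        refine ⟨v, hv, fun F hvF => ?_⟩
        by_contra hne
        obtain ⟨a, b, c⟩ := hsupp F hne
        obtain ⟨x, hx, y, hy, z, hz, rfl⟩ := h.exists_triple a b c
        have := hh ⟨x, hx⟩ ⟨y, hy⟩ ⟨z, hz⟩ hvF
        rw [← hT'] at this
        exact mul_ne_zero (sgnz x y z) hne this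
      rcases hex with ⟨x, hx⟩ | ⟨y, hy⟩ | ⟨z, hz⟩
      · refine aux x.1 (h.un ▸ by simp) fun x' y' z' hm => ?_
        simp only [Finset.mem_insert, Finset.mem_singleton, hxy x.2 y'.2, hxz x.2 z'.2,
          or_false] at hm
        rw [← Subtype.ext hm]; exact hx _ _
      · refine aux y.1 (h.un ▸ by simp) fun x' y' z' hm => ?_
        simp only [Finset.mem_insert, Finset.mem_singleton, (hxy x'.2 y.2).symm, hyz y.2 z'.2,
          or_false, false_or] at hm
        rw [← Subtype.ext hm]; exact hy _ _
      · refine aux z.1 (h.un ▸ by simp) fun x' y' z' hm => ?_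
        simp only [Finset.mem_insert, Finset.mem_singleton, (hxz x'.2 z.2).symm,
          (hyz y'.2 z.2).symm, false_or] at hm
        rw [← Subtype.ext hm]; exact hz _ _
    obtain ⟨v, hv, hvF⟩ := hex'
    have hz := hmin g' hcyc v hv hvF
    intro x y z
    rw [← hT', hz]
    simp [tens]


/-- Let `Γ` be a balanced two-dimensional complex and `W` a
minimal vertex set with `H̃_2(Γ[W]; k) ≠ 0`.  Then `Γ[W]` has at least `2|W| - 4`
two-dimensional faces. -/
theorem min_homology_face_count {V : Type*} [LinearOrder V] (k : Type*) [Field k]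
    (Γ : SC V) (hdim : ∀ F ∈ Γ.faces, F.card ≤ 3)
    (hbal : ∃ X Y Z : Finset V, Disjoint X Y ∧ Disjoint X Z ∧ Disjoint Y Z ∧
      (∀ v : V, ({v} : Finset V) ∈ Γ.faces → v ∈ X ∪ Y ∪ Z) ∧
      ∀ F ∈ Γ.faces, (F ∩ X).card ≤ 1 ∧ (F ∩ Y).card ≤ 1 ∧ (F ∩ Z).card ≤ 1)
    (W : Finset V) (hW : SC.HNonzero k (Γ.restrict ↑W) 3)
    (hmin : ∀ W' : Finset V, W' ⊂ W → ¬ SC.HNonzero k (Γ.restrict ↑W') 3) :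
    2 * W.card - 4 ≤
      Set.ncard {F | F ∈ Γ.faces ∧ F.card = 3 ∧ ↑F ⊆ (↑W : Set V)} := by
  obtain ⟨X, Y, Z, hXY, hXZ, hYZ, hcov, hcol⟩ := hbal
  obtain ⟨g, hg0, hg⟩ := (hnonzero_iff k Γ hdim W).1 hW
  have hm : ∀ g' : Finset V → k, IsCyc Γ W g' → ∀ v ∈ W, (∀ F, v ∈ F → g' F = 0) → g' = 0 := by
    intro g' hc v hv hF
    by_contra hne
    exact hmin (W.erase v) (Finset.erase_ssubset hv)
      ((hnonzero_iff k Γ hdim _).2 ⟨g', hne, isCyc_erase hc hF⟩)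
  have hWsub : W ⊆ X ∪ Y ∪ Z := by
    intro v hv
    apply hcov
    by_contra hnf
    apply hg0
    apply hm g hg v hv
    intro F hvF
    by_contra hne
    exact hnf (Γ.down_closed (hg.1 F hne).1 (Finset.singleton_subset_iff.2 hvF))
  have hle : ∀ F U : Finset V, (F ∩ U).card ≤ 1 → (F ∩ (W ∩ U)).card ≤ 1 := fun F U h =>
    (Finset.card_le_card (Finset.inter_subset_inter_left Finset.inter_subset_right)).trans h
  have hB : Bal Γ W (W ∩ X) (W ∩ Y) (W ∩ Z) :=
    ⟨hXY.mono Finset.inter_subset_right Finset.inter_subset_right,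
      hXZ.mono Finset.inter_subset_right Finset.inter_subset_right,
      hYZ.mono Finset.inter_subset_right Finset.inter_subset_right,
      by rw [← Finset.inter_union_distrib_left, ← Finset.inter_union_distrib_left,
          Finset.inter_eq_left.2 hWsub],
      fun F hF => hle F X (hcol F hF).1, fun F hF => hle F Y (hcol F hF).2.1,
      fun F hF => hle F Z (hcol F hF).2.2⟩
  have := hB.count g hg hg0 hm
  omega
end

section
/- For each p ≥ 2 there exists a constant C_p > 0 such that for arbitrarily large n there exists a (p−1)-dimensional simplicial complex Γ with n vertices satisfying gr_{p−1}(Γ) > 2p and f_{p−1}(Γ) ≥ C_p · n^{p − p/(2^p − 1)}. -/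
open Finset

namespace HG

/-! ### Deletion method -/

lemma weight_sum {U : Type*} [Fintype U] [DecidableEq U] (a : ℝ) (B : Finset U) :
    ∑ T : Finset U, (a ^ T.card * (1 - a) ^ (univ \ T).card) * (if B ⊆ T then 1 else 0)
      = a ^ B.card := by
  have h := Finset.prod_add (fun _ : U => a) (fun u => if u ∈ B then 0 else 1 - a) univ
  have h1 : ∏ i : U, (a + if i ∈ B then 0 else 1 - a) = a ^ B.card := by
    have : ∀ i : U, (a + if i ∈ B then 0 else 1 - a) = if i ∈ B then a else 1 := by
      intro i; split_ifs <;> ring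
    simp only [this]
    rw [Finset.prod_ite]
    simp
  rw [h1] at h
  rw [h, Finset.powerset_univ]
  refine Finset.sum_congr rfl fun T _ => ?_
  rw [Finset.prod_const]
  by_cases hBT : B ⊆ T
  · have : ∏ u ∈ univ \ T, (if u ∈ B then 0 else 1 - a) = (1 - a) ^ (univ \ T).card := by
      rw [← Finset.prod_const]
      refine Finset.prod_congr rfl fun u hu => ?_
      rw [if_neg]
      intro hB
      exact (Finset.mem_sdiff.1 hu).2 (hBT hB)
    rw [this]; simp [hBT]
  · obtain ⟨u, huB, huT⟩ := Finset.not_subset.1 hBT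
    have : ∏ u ∈ univ \ T, (if u ∈ B then 0 else 1 - a) = 0 :=
      Finset.prod_eq_zero (i := u) (by simp [huT]) (by simp [huB])
    rw [this]; simp [hBT]

lemma exists_good {U ι : Type*} [Fintype U] [DecidableEq U] (I : Finset ι)
    (B : ι → Finset U) (r : ℕ) (hB : ∀ j ∈ I, (B j).card = r) (a : ℝ) (h0 : 0 ≤ a) (h1 : a ≤ 1) :
    ∃ T : Finset U, a * Fintype.card U - I.card * a ^ r ≤
      (T.card : ℝ) - ((I.filter (fun j => B j ⊆ T)).card : ℝ) := by
  by_contra hcon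
  push Not at hcon
  set w : Finset U → ℝ := fun T => a ^ T.card * (1 - a) ^ (univ \ T).card with hw
  have hw0 : ∀ T, 0 ≤ w T := fun T =>
    mul_nonneg (pow_nonneg h0 _) (pow_nonneg (by linarith) _)
  have hw1 : ∑ T, w T = 1 := by
    have := weight_sum (U := U) a ∅
    simpa using this
  have hE : ∑ T, w T * ((T.card : ℝ) - ((I.filter (fun j => B j ⊆ T)).card : ℝ))
      = a * Fintype.card U - I.card * a ^ r := by
    simp only [mul_sub, Finset.sum_sub_distrib]
    congr 1
    · have : ∀ T : Finset U, (T.card : ℝ) = ∑ u : U, if {u} ⊆ T then (1 : ℝ) else 0 := by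
        intro T; simp
      simp only [this, Finset.mul_sum]
      rw [Finset.sum_comm]
      have h2 : ∀ u : U, ∑ T : Finset U, w T * (if {u} ⊆ T then (1 : ℝ) else 0) = a := by
        intro u
        have := weight_sum a ({u} : Finset U)
        rw [Finset.card_singleton, pow_one] at this
        exact this
      rw [Finset.sum_congr rfl (fun u _ => h2 u)]
      simp [mul_comm]
    · have : ∀ T : Finset U, ((I.filter (fun j => B j ⊆ T)).card : ℝ)
          = ∑ j ∈ I, if B j ⊆ T then (1 : ℝ) else 0 := by
        intro T; simp
      simp only [this, Finset.mul_sum]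
      rw [Finset.sum_comm]
      rw [Finset.sum_congr rfl (fun j hj => (weight_sum a (B j)).trans (by rw [hB j hj]))]
      simp
  have hex : ∃ T ∈ (univ : Finset (Finset U)), 0 < w T := by
    by_contra hh
    push Not at hh
    have := Finset.sum_nonpos hh
    linarith
  obtain ⟨T0, _, hT0⟩ := hex
  have hlt : ∑ T, w T * ((T.card : ℝ) - ((I.filter (fun j => B j ⊆ T)).card : ℝ)) <
      ∑ T, w T * (a * Fintype.card U - I.card * a ^ r) := by
    refine Finset.sum_lt_sum (fun T _ => mul_le_mul_of_nonneg_left (hcon T).le (hw0 T))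
      ⟨T0, mem_univ _, mul_lt_mul_of_pos_left (hcon T0) hT0⟩
  rw [hE, ← Finset.sum_mul, hw1, one_mul] at hlt
  exact lt_irrefl _ hlt

lemma deletion {U ι : Type*} [Fintype U] [DecidableEq U] (I : Finset ι)
    (B : ι → Finset U) (r : ℕ) (hr : 0 < r)
    (hB : ∀ j ∈ I, (B j).card = r) (a : ℝ) (h0 : 0 ≤ a) (h1 : a ≤ 1) :
    ∃ T : Finset U, a * Fintype.card U - I.card * a ^ r ≤ (T.card : ℝ) ∧
      ∀ j ∈ I, ¬ B j ⊆ T := by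
  classical
  obtain ⟨T, hT⟩ := exists_good I B r hB a h0 h1
  have hne : ∀ j : I, ∃ u, u ∈ B j := fun j => by
    have : (B j).Nonempty := by rw [← Finset.card_pos, hB j j.2]; exact hr
    exact this
  choose f hf using hne
  set J : Finset {x // x ∈ I} := Finset.filter (fun j : {x // x ∈ I} => B j ⊆ T) I.attach with hJdef
  have hJ : J.card = (I.filter (fun j => B j ⊆ T)).card := by
    rw [← Finset.card_map (Function.Embedding.subtype _)]
    congr 1
    ext j
    simp [J, and_comm]
  refine ⟨T \ J.image f, ?_, ?_⟩
  · have h2 : T.card ≤ (T \ J.image f).card + (J.image f).card := by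
      have := Finset.le_card_sdiff (J.image f) T
      omega
    have h3 : (J.image f).card ≤ J.card := Finset.card_image_le
    rw [hJ] at h3
    have : (T.card : ℝ) ≤ (T \ J.image f).card + (I.filter (fun j => B j ⊆ T)).card := by
      exact_mod_cast h2.trans (by omega)
    linarith
  · intro j hj hsub
    have h4 := hsub (hf ⟨j, hj⟩)
    rw [Finset.mem_sdiff] at h4
    apply h4.2
    refine Finset.mem_image_of_mem f (a := ⟨j, hj⟩) ?_
    simp only [J, Finset.mem_filter, Finset.mem_attach, true_and]
    exact hsub.trans Finset.sdiff_subset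

/-- The transversals of the cross-polytope spanned by `x` and `y`. -/
noncomputable def block {p m : ℕ} (xy : (Fin p → Fin m) × (Fin p → Fin m)) :
    Finset (Fin p → Fin m) :=
  univ.image (fun s : Finset (Fin p) => s.piecewise xy.1 xy.2)

lemma block_card {p m : ℕ} (xy : (Fin p → Fin m) × (Fin p → Fin m))
    (h : ∀ i, xy.1 i ≠ xy.2 i) : (block xy).card = 2 ^ p := by
  unfold block
  rw [Finset.card_image_of_injective]
  · simp
  · intro s t hst
    ext i
    have := congrFun hst i
    by_cases hs : i ∈ s <;> by_cases ht : i ∈ t <;> simp [hs, ht] at this ⊢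
    · exact h i this
    · exact h i this.symm

lemma exists_free (p m : ℕ) (hp : 2 ≤ p) (hm : 1 ≤ m) :
    ∃ T : Finset (Fin p → Fin m),
      (1 / 4 : ℝ) * (m : ℝ) ^ ((p : ℝ) - p / (2 ^ p - 1)) ≤ T.card ∧
      ∀ x y : Fin p → Fin m, (∀ i, x i ≠ y i) → ∃ s : Finset (Fin p), s.piecewise x y ∉ T := by
  classical
  set e : ℝ := (p : ℝ) / (2 ^ p - 1) with he
  have h2p : (4 : ℝ) ≤ 2 ^ p := by
    calc (4 : ℝ) = 2 ^ 2 := by norm_num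
      _ ≤ 2 ^ p := pow_le_pow_right₀ (by norm_num) hp
  have hpR : (2 : ℝ) ≤ p := by exact_mod_cast hp
  have hmR : (1 : ℝ) ≤ m := by exact_mod_cast hm
  have hm0 : (0 : ℝ) < m := by linarith
  have he0 : 0 ≤ e := div_nonneg (by linarith) (by linarith)
  set b : ℝ := (m : ℝ) ^ (-e) with hb
  have hb0 : 0 < b := Real.rpow_pos_of_pos hm0 _
  have hb1 : b ≤ 1 := Real.rpow_le_one_of_one_le_of_nonpos hmR (by linarith)
  obtain ⟨q, hq⟩ : ∃ q, 2 ^ p = q + 1 := ⟨2 ^ p - 1, by have := Nat.one_le_two_pow (n := p); omega⟩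
  have hqR : (2 : ℝ) ^ p = q + 1 := by exact_mod_cast hq
  have hq1 : 1 ≤ q := by
    have : (3 : ℝ) ≤ q := by linarith
    have : 3 ≤ q := by exact_mod_cast this
    omega
  have hbq : b ^ q * (m : ℝ) ^ p = 1 := by
    rw [hb, ← Real.rpow_natCast, ← Real.rpow_mul hm0.le, ← Real.rpow_natCast (m : ℝ) p,
      ← Real.rpow_add hm0]
    have : -e * q + p = 0 := by
      have : (q : ℝ) ≠ 0 := by positivity
      rw [he, hqR, add_sub_cancel_right]; field_simp; ring
    rw [this, Real.rpow_zero]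
  set I : Finset ((Fin p → Fin m) × (Fin p → Fin m)) :=
    univ.filter (fun xy => ∀ i, xy.1 i ≠ xy.2 i) with hI
  obtain ⟨T, hT, hfree⟩ := deletion I block (2 ^ p) (by positivity)
    (fun j hj => block_card j (by simpa [hI] using hj)) (b / 2) (by linarith) (by linarith)
  refine ⟨T, ?_, ?_⟩
  · refine le_trans ?_ hT
    have hIc : (I.card : ℝ) ≤ (m : ℝ) ^ p * (m : ℝ) ^ p := by
      have : I.card ≤ m ^ p * m ^ p := by
        refine (Finset.card_le_univ I).trans ?_
        simp
      exact_mod_cast this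
    have hU : (Fintype.card (Fin p → Fin m) : ℝ) = (m : ℝ) ^ p := by simp
    rw [hU]
    have hexp : (m : ℝ) ^ ((p : ℝ) - e) = (m : ℝ) ^ p * b := by
      rw [hb, sub_eq_add_neg, Real.rpow_add hm0, Real.rpow_natCast]
    rw [hexp, hq]
    have hhalf : (1 / 2 : ℝ) ^ q ≤ 1 / 2 := by
      calc (1 / 2 : ℝ) ^ q ≤ (1 / 2) ^ 1 :=
            pow_le_pow_of_le_one (by norm_num) (by norm_num) hq1
        _ = 1 / 2 := by norm_num
    have hM : (0 : ℝ) < (m : ℝ) ^ p := by positivity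
    have h5 : (I.card : ℝ) * (b / 2) ^ (q + 1) ≤ (m : ℝ) ^ p * b / 4 := by
      calc (I.card : ℝ) * (b / 2) ^ (q + 1)
          ≤ ((m : ℝ) ^ p * (m : ℝ) ^ p) * (b / 2) ^ (q + 1) := by gcongr
        _ = (b ^ q * (m : ℝ) ^ p) * ((m : ℝ) ^ p * b / 2) * (1 / 2) ^ q := by
            rw [pow_succ, div_eq_mul_one_div b 2, mul_pow]; ring
        _ ≤ 1 * ((m : ℝ) ^ p * b / 2) * (1 / 2) := by rw [hbq]; gcongr
        _ = _ := by ring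
    linarith
  · intro x y hxy
    have := hfree (x, y) (by simpa [hI] using hxy)
    obtain ⟨z, hz, hzT⟩ := Finset.not_subset.1 this
    simp only [block, Finset.mem_image, Finset.mem_univ, true_and] at hz
    obtain ⟨s, rfl⟩ := hz
    exact ⟨s, hzT⟩

/-! ### Cycles -/

lemma bdFace_apply_self {V : Type*} [LinearOrder V] (k : Type*) [Field k] (K : SC V) (n : ℕ)
    (F : SC.faceSet K (n + 1)) (v : V) (hv : v ∈ (F : Finset V)) (G : SC.faceSet K n)
    (hG : (G : Finset V) = (F : Finset V).erase v) : SC.bdFace k K n F G ≠ 0 := by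
  classical
  unfold SC.bdFace
  rw [Finsupp.finsetSum_apply, Finset.sum_eq_single ⟨v, hv⟩]
  · have : (⟨(F : Finset V).erase v, K.down_closed F.2.1 (Finset.erase_subset _ _),
        by rw [Finset.card_erase_of_mem hv, F.2.2]; rfl⟩ : SC.faceSet K n) = G :=
      Subtype.ext hG.symm
    simp [this]
  · intro u _ hu
    rw [Finsupp.smul_apply, Finsupp.single_eq_of_ne, smul_zero]
    intro h
    have h' : (G : Finset V) = (F : Finset V).erase u := congrArg Subtype.val h
    rw [hG] at h'
    apply hu
    apply Subtype.ext
    by_contra hne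
    have : (u : V) ∈ (F : Finset V).erase v := Finset.mem_erase.2 ⟨hne, u.2⟩
    rw [h'] at this
    simp at this
  · simp

lemma bdFace_apply_zero {V : Type*} [LinearOrder V] (k : Type*) [Field k] (K : SC V) (n : ℕ)
    (F : SC.faceSet K (n + 1)) (G : SC.faceSet K n)
    (hG : ¬ (G : Finset V) ⊆ (F : Finset V)) : SC.bdFace k K n F G = 0 := by
  classical
  unfold SC.bdFace
  rw [Finsupp.finsetSum_apply]
  refine Finset.sum_eq_zero fun u _ => ?_
  rw [Finsupp.smul_apply, Finsupp.single_eq_of_ne, smul_zero]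
  intro h
  have h' : (G : Finset V) = (F : Finset V).erase u := congrArg Subtype.val h
  exact hG (h' ▸ Finset.erase_subset _ _)

lemma cycle_other {V : Type*} [LinearOrder V] (k : Type*) [Field k] (K : SC V) (n : ℕ)
    (z : SC.Chains k K (n + 1)) (hz : SC.bd k K n z = 0) (F : SC.faceSet K (n + 1))
    (hF : z F ≠ 0) (v : V) (hv : v ∈ (F : Finset V)) :
    ∃ F' : SC.faceSet K (n + 1), F' ≠ F ∧ z F' ≠ 0 ∧ (F : Finset V).erase v ⊆ F' := by
  classical
  by_contra hcon
  push Not at hcon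
  let G : SC.faceSet K n := ⟨(F : Finset V).erase v,
    K.down_closed F.2.1 (Finset.erase_subset _ _),
        by rw [Finset.card_erase_of_mem hv, F.2.2]; rfl⟩
  have h0 : SC.bd k K n z G = 0 := by rw [hz]; rfl
  have h1 : SC.bd k K n z G = z F * SC.bdFace k K n F G := by
    unfold SC.bd
    rw [Finsupp.lsum_apply, Finsupp.sum, Finsupp.finsetSum_apply, Finset.sum_eq_single F]
    · simp
    · intro F' hF' hne
      have := bdFace_apply_zero k K n F' G (hcon F' hne (by simpa using hF'))
      simp [this]
    · intro h; simp [Finsupp.notMem_support_iff.1 h]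
  rw [h1] at h0
  exact mul_ne_zero hF (bdFace_apply_self k K n F v hv G rfl) h0

/-! ### Combinatorics of the support -/

lemma closed_contains_block {p m : ℕ} (S : Set (Fin p → Fin m)) (hne : S.Nonempty)
    (hflip : ∀ x ∈ S, ∀ i, ∃ y ∈ S, y i ≠ x i ∧ ∀ j, j ≠ i → y j = x j)
    (W : Finset (Fin p × Fin m)) (hW : ∀ x ∈ S, ∀ i, (i, x i) ∈ W) (hc : W.card ≤ 2 * p) :
    ∃ x y : Fin p → Fin m, (∀ i, x i ≠ y i) ∧ ∀ s : Finset (Fin p), s.piecewise x y ∈ S := by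
  classical
  obtain ⟨x0, hx0⟩ := hne
  choose y hyS hyi hyj using hflip x0 hx0
  set A : Fin p → Finset (Fin p × Fin m) := fun i => W.filter (fun a => a.1 = i) with hA
  have hsum : ∑ i, (A i).card = W.card :=
    (Finset.card_eq_sum_card_fiberwise (f := Prod.fst) (t := univ) (by simp)).symm
  have hpair : ∀ i, ({(i, x0 i), (i, y i i)} : Finset (Fin p × Fin m)) ⊆ A i := by
    intro i a ha
    simp only [Finset.mem_insert, Finset.mem_singleton] at ha
    rcases ha with rfl | rfl
    · simp [hA, hW x0 hx0 i]
    · simp [hA, hW (y i) (hyS i) i]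
  have hpc : ∀ i, ({(i, x0 i), (i, y i i)} : Finset (Fin p × Fin m)).card = 2 := by
    intro i
    rw [Finset.card_pair]
    intro h
    exact hyi i (congrArg Prod.snd h).symm
  have h2 : ∀ i, 2 ≤ (A i).card := fun i => (hpc i).symm.le.trans (Finset.card_le_card (hpair i))
  have h2' : ∀ i, (A i).card = 2 := by
    have hs : ∑ i : Fin p, 2 = ∑ i, (A i).card := by
      apply le_antisymm (Finset.sum_le_sum fun i _ => h2 i)
      rw [hsum]; simpa [mul_comm] using hc
    intro i
    exact ((Finset.sum_eq_sum_iff_of_le (fun i _ => h2 i)).1 hs i (mem_univ _)).symm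
  have hAeq : ∀ i, ({(i, x0 i), (i, y i i)} : Finset (Fin p × Fin m)) = A i := fun i =>
    Finset.eq_of_subset_of_card_le (hpair i) (by rw [h2', hpc])
  have hval : ∀ x ∈ S, ∀ i, x i = x0 i ∨ x i = y i i := by
    intro x hx i
    have : (i, x i) ∈ A i := by simp [hA, hW x hx i]
    rw [← hAeq i] at this
    simpa using this
  refine ⟨fun i => y i i, x0, hyi, ?_⟩
  intro s
  induction s using Finset.induction_on with
  | empty => simpa using hx0
  | insert j s hj ih =>
    rw [Finset.piecewise_insert]
    obtain ⟨z, hzS, hzj, hz⟩ := hflip _ ih j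
    convert hzS
    ext1 i
    by_cases hij : i = j
    · subst hij
      rw [Function.update_self]
      rw [Finset.piecewise_eq_of_notMem _ _ _ hj] at hzj
      rcases hval z hzS i with h | h
      · exact absurd h hzj
      · exact h.symm
    · rw [Function.update_of_ne hij, hz i hij]

/-! ### The complex -/

/-- The face of a transversal. -/
def face {p m : ℕ} (x : Fin p → Fin m) : Finset (Fin (p * m)) :=
  univ.image (fun i => finProdFinEquiv (i, x i))

lemma mem_face {p m : ℕ} (x : Fin p → Fin m) (i : Fin p) (a : Fin m) :
    finProdFinEquiv (i, a) ∈ face x ↔ x i = a := by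
  simp only [face, Finset.mem_image, Finset.mem_univ, true_and]
  constructor
  · rintro ⟨j, hj⟩
    have := finProdFinEquiv.injective hj
    rw [Prod.mk.injEq] at this
    obtain ⟨rfl, h⟩ := this
    exact h
  · rintro rfl; exact ⟨i, rfl⟩

lemma face_injective {p m : ℕ} : Function.Injective (face (p := p) (m := m)) := by
  intro x y h
  ext1 i
  have : finProdFinEquiv (i, x i) ∈ face y := by rw [← h, mem_face]
  exact ((mem_face y i _).1 this).symm

lemma face_card {p m : ℕ} (x : Fin p → Fin m) : (face x).card = p := by
  unfold face
  rw [Finset.card_image_of_injective]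
  · simp
  · intro i j h
    exact congrArg Prod.fst (finProdFinEquiv.injective h)

/-- The complex with full `(p-2)`-skeleton and top faces given by `T`. -/
def cpx {p m : ℕ} (T : Finset (Fin p → Fin m)) : SC (Fin (p * m)) where
  faces := {F | F.card < p ∨ ∃ x ∈ T, F = face x}
  down_closed := by
    intro F G hF hGF
    rcases hF with h | ⟨x, hx, rfl⟩
    · exact Or.inl ((Finset.card_le_card hGF).trans_lt h)
    · by_cases hG : G = face x
      · exact Or.inr ⟨x, hx, hG⟩
      · left
        have := Finset.card_lt_card (lt_of_le_of_ne hGF hG)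
        rwa [face_card] at this

lemma cpx_card {p m : ℕ} (T : Finset (Fin p → Fin m)) (F : Finset (Fin (p * m)))
    (hF : F ∈ (cpx T).faces) : F.card ≤ p := by
  rcases hF with h | ⟨x, _, rfl⟩
  · exact h.le
  · exact (face_card x).le

lemma cpx_top {p m : ℕ} (T : Finset (Fin p → Fin m)) (F : Finset (Fin (p * m)))
    (hF : F ∈ (cpx T).faces) (hc : F.card = p) : ∃ x ∈ T, F = face x := by
  rcases hF with h | h
  · omega
  · exact h

lemma cpx_ncard {p m : ℕ} (T : Finset (Fin p → Fin m)) :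
    Set.ncard {F | F ∈ (cpx T).faces ∧ F.card = p} = T.card := by
  classical
  have : {F | F ∈ (cpx T).faces ∧ F.card = p} = ((T.image face : Finset _) : Set _) := by
    ext F
    simp only [Set.mem_setOf_eq, Finset.coe_image, Set.mem_image, Finset.mem_coe]
    constructor
    · rintro ⟨h, hc⟩
      obtain ⟨x, hx, rfl⟩ := cpx_top T F h hc
      exact ⟨x, hx, rfl⟩
    · rintro ⟨x, hx, rfl⟩
      exact ⟨Or.inr ⟨x, hx, rfl⟩, face_card x⟩
  rw [this, Set.ncard_coe_finset, Finset.card_image_of_injective _ face_injective]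

lemma no_homology {p m : ℕ} (hp : 2 ≤ p) (k : Type*) [Field k] (T : Finset (Fin p → Fin m))
    (hT : ∀ x y : Fin p → Fin m, (∀ i, x i ≠ y i) → ∃ s : Finset (Fin p), s.piecewise x y ∉ T)
    (W : Finset (Fin (p * m))) (hW : W.card ≤ 2 * p) (F : Finset (Fin (p * m))) :
    ¬ SC.HNonzero k (((cpx T).link F).restrict ↑W) p := by
  classical
  set L := ((cpx T).link F).restrict (W : Set (Fin (p * m))) with hL
  intro hH
  apply hH
  have htop : ∀ G ∈ SC.faceSet L p, G ⊆ W ∧ ∃ x ∈ T, G = face x := by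
    rintro G ⟨⟨⟨hd, hG⟩, hGW⟩, hc⟩
    refine ⟨by exact_mod_cast hGW, ?_⟩
    have h1 := cpx_card T _ hG
    rw [Finset.card_union_of_disjoint hd, hc] at h1
    have h2 : F = ∅ := Finset.card_eq_zero.1 (by omega)
    subst h2
    rw [Finset.empty_union] at hG
    exact cpx_top T G hG hc
  obtain ⟨q, rfl⟩ : ∃ q, p = q + 1 := ⟨p - 1, by omega⟩
  intro z hz
  have hz' : SC.bd k L q z = 0 := hz
  suffices z = 0 by rw [this]; exact Submodule.zero_mem _
  by_contra hz0
  set S : Set (Fin (q + 1) → Fin m) := {x | ∃ h : face x ∈ SC.faceSet L (q + 1), z ⟨face x, h⟩ ≠ 0}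
  have hST : ∀ x ∈ S, x ∈ T := by
    rintro x ⟨h, -⟩
    obtain ⟨-, y, hy, hxy⟩ := htop _ h
    rwa [face_injective hxy]
  have hSmk : ∀ G : SC.faceSet L (q + 1), z G ≠ 0 → ∃ x ∈ S, (G : Finset _) = face x := by
    rintro ⟨G, hG⟩ hzG
    obtain ⟨-, x, hx, rfl⟩ := htop G hG
    exact ⟨x, ⟨hG, hzG⟩, rfl⟩
  have hb1 : S.Nonempty := by
    obtain ⟨G, hG⟩ := Finsupp.ne_iff.1 hz0
    obtain ⟨x, hx, -⟩ := hSmk G hG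
    exact ⟨x, hx⟩
  have hb2 : ∀ x ∈ S, ∀ i, ∃ y ∈ S, y i ≠ x i ∧ ∀ j, j ≠ i → y j = x j := by
    rintro x ⟨h, hx⟩ i
    obtain ⟨F', hne, hF', hsub⟩ := cycle_other k L q z hz' ⟨face x, h⟩ hx
      (finProdFinEquiv (i, x i)) ((mem_face x i _).2 rfl)
    obtain ⟨y, hy, hFy⟩ := hSmk F' hF'
    have hagree : ∀ j, j ≠ i → y j = x j := by
      intro j hj
      rw [← mem_face, ← hFy]
      apply hsub
      rw [Finset.mem_erase]
      refine ⟨?_, (mem_face x j _).2 rfl⟩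
      intro h
      exact hj (congrArg Prod.fst (finProdFinEquiv.injective h))
    refine ⟨y, hy, ?_, hagree⟩
    intro hyx
    apply hne
    apply Subtype.ext
    rw [hFy]
    congr 1
    ext1 j
    by_cases hj : j = i
    · rw [hj, hyx]
    · exact hagree j hj
  have hb3 : ∀ x ∈ S, ∀ i, (i, x i) ∈ W.map finProdFinEquiv.symm.toEmbedding := by
    rintro x ⟨h, -⟩ i
    have := (htop _ h).1 ((mem_face x i _).2 rfl)
    rw [Finset.mem_map_equiv]
    simpa using this
  obtain ⟨x, y, hxy, hs⟩ := closed_contains_block S hb1 hb2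
    (W.map finProdFinEquiv.symm.toEmbedding) hb3 (by simpa using hW)
  obtain ⟨s, hs'⟩ := hT x y hxy
  exact hs' (hST _ (hs s))

end HG

/-- For each `p ≥ 2` there is a constant `C_p > 0` such that for
arbitrarily large `n` there is a `(p-1)`-dimensional complex `Γ` on `n` vertices
with `gr_{p-1}(Γ) > 2p` and `f_{p-1}(Γ) ≥ C_p n^{p - p/(2^p - 1)}`. -/
theorem exists_high_girth_many_faces (p : ℕ) (hp : 2 ≤ p)
    (k : Type*) [Field k] :
    ∃ C : ℝ, 0 < C ∧ ∀ N : ℕ, ∃ n, N ≤ n ∧ ∃ K : SC (Fin n),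
      (∀ v : Fin n, ({v} : Finset (Fin n)) ∈ K.faces) ∧
      (∀ F ∈ K.faces, F.card ≤ p) ∧ (∃ F ∈ K.faces, F.card = p) ∧
      ((2 * p : ℕ) : ℕ∞) < SC.girth k K p ∧
      C * (n : ℝ) ^ ((p : ℝ) - p / (2 ^ p - 1)) ≤
        (Set.ncard {F | F ∈ K.faces ∧ F.card = p} : ℝ) := by
  have hp0 : (0 : ℝ) < p := by
    have : 0 < p := by omega
    exact_mod_cast this
  have hpe : 0 < (p : ℝ) ^ ((p : ℝ) - p / (2 ^ p - 1)) := Real.rpow_pos_of_pos hp0 _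
  refine ⟨(1 / 4) / (p : ℝ) ^ ((p : ℝ) - p / (2 ^ p - 1)), by positivity, fun N => ?_⟩
  obtain ⟨T, hTc, hT⟩ := HG.exists_free p (N + 1) hp (by omega)
  refine ⟨p * (N + 1), by nlinarith, HG.cpx T, ?_, HG.cpx_card T, ?_, ?_, ?_⟩
  · intro v
    left
    rw [Finset.card_singleton]; omega
  · have hpos : (0 : ℝ) < T.card := by
      refine lt_of_lt_of_le ?_ hTc
      have : (0 : ℝ) < ((N + 1 : ℕ) : ℝ) := by positivity
      have := Real.rpow_pos_of_pos this ((p : ℝ) - p / (2 ^ p - 1))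
      linarith
    have hpos' : 0 < T.card := by exact_mod_cast hpos
    obtain ⟨x, hx⟩ := Finset.card_pos.1 hpos'
    exact ⟨HG.face x, Or.inr ⟨x, hx, rfl⟩, HG.face_card x⟩
  · refine lt_of_lt_of_le (b := ((2 * p + 1 : ℕ) : ℕ∞)) (by exact_mod_cast Nat.lt_succ_self _) ?_
    refine le_sInf ?_
    rintro _ ⟨W, ⟨F, -, hH⟩, rfl⟩
    by_contra hlt
    push Not at hlt
    have hlt' : W.card < 2 * p + 1 := by exact_mod_cast hlt
    exact HG.no_homology hp k T hT W (by omega) F hH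
  · rw [HG.cpx_ncard]
    refine le_trans (le_of_eq ?_) hTc
    rw [Nat.cast_mul, Real.mul_rpow hp0.le (by positivity)]
    field_simp
end

section
/- Let G be a graph with n vertices, m edges, average degree a = 2m/n ≥ 2, and girth greater than 2r (r ≥ 1). Then n ≥ 2·∑_{i=0}^{r−1} (a−1)^i. -/
/-- Every cycle is longer than `2r`. -/
def MBGirth {V : Type*} (G : SimpleGraph V) (r : ℕ) : Prop :=
  ∀ (v : V) (w : G.Walk v v), w.IsCycle → 2 * r < w.length

lemma mb_unique {V : Type*} [DecidableEq V] {G : SimpleGraph V} {r : ℕ} (hg : MBGirth G r) {u w : V}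
    (p : G.Walk u w) : ∀ (q : G.Walk u w), p.IsPath → q.IsPath →
      p.length + q.length ≤ 2 * r → p = q := by
  induction p with
  | nil =>
    intro q _ hq _
    exact (SimpleGraph.Walk.isPath_iff_eq_nil.1 hq).symm
  | @cons u x w h p ih =>
    intro q hp hq hl
    have hp' := (SimpleGraph.Walk.cons_isPath_iff _ _).1 hp
    rw [SimpleGraph.Walk.length_cons] at hl
    by_cases hx : x ∈ q.support
    · cases q with
      | nil =>
        have := SimpleGraph.Walk.isPath_iff_eq_nil.1 hp
        simp at this
      | @cons _ y _ h' q =>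
        by_cases hxy : x = y
        · subst hxy
          have hq' := (SimpleGraph.Walk.cons_isPath_iff _ _).1 hq
          rw [SimpleGraph.Walk.length_cons] at hl
          rw [ih q hp'.1 hq'.1 (by omega)]
        · exfalso
          have hq' := (SimpleGraph.Walk.cons_isPath_iff _ _).1 hq
          have hc : (SimpleGraph.Walk.cons h.symm
              ((SimpleGraph.Walk.cons h' q).takeUntil x hx)).IsCycle := by
            rw [SimpleGraph.Walk.cons_isCycle_iff]
            refine ⟨hq.takeUntil hx, fun hm => ?_⟩
            have hm := SimpleGraph.Walk.edges_takeUntil_subset_edges _ hx hm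
            rw [SimpleGraph.Walk.edges_cons, List.mem_cons] at hm
            rcases hm with hm | hm
            · rw [Sym2.eq_swap, Sym2.congr_right] at hm
              exact hxy hm
            · exact hq'.2 (SimpleGraph.Walk.snd_mem_support_of_mem_edges _ hm)
          have h1 := hg _ _ hc
          have h2 := SimpleGraph.Walk.length_takeUntil_le_length (SimpleGraph.Walk.cons h' q) hx
          rw [SimpleGraph.Walk.length_cons] at h1
          omega
    · exfalso
      have := ih (SimpleGraph.Walk.cons h.symm q) hp'.1
        ((SimpleGraph.Walk.cons_isPath_iff _ _).2 ⟨hq, hx⟩)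
        (by rw [SimpleGraph.Walk.length_cons]; omega)
      apply hp'.2
      rw [this]
      simp

/-- Nonbacktracking walk counts. -/
def mbN {V : Type*} [Fintype V] [DecidableEq V]
    (G : SimpleGraph V) [DecidableRel G.Adj] : ℕ → V → V → ℝ
  | 0, _, _ => 1
  | i + 1, u, v => ∑ x ∈ (G.neighborFinset v).erase u, mbN G i v x

open Classical in
/-- Endpoints of paths starting with the dart `u → v`. -/
noncomputable def mbT {V : Type*} [Fintype V]
    (G : SimpleGraph V) (i : ℕ) (u v : V) : Finset V :=
  Finset.univ.filter fun w => ∃ p : G.Walk v w, p.IsPath ∧ p.length = i ∧ u ∉ p.support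

lemma mb_mem_T {V : Type*} [Fintype V] (G : SimpleGraph V) (i : ℕ) (u v w : V) :
    w ∈ mbT G i u v ↔ ∃ p : G.Walk v w, p.IsPath ∧ p.length = i ∧ u ∉ p.support := by
  simp [mbT]

lemma mb_N_le {V : Type*} [Fintype V] [DecidableEq V]
    (G : SimpleGraph V) [DecidableRel G.Adj] (r : ℕ) (hg : MBGirth G r) (i : ℕ) (hi : i < r) :
    ∀ u v : V, G.Adj u v → mbN G i u v ≤ (mbT G i u v).card := by
  induction i with
  | zero =>
    intro u v h
    have : v ∈ mbT G 0 u v := by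
      rw [mb_mem_T]
      exact ⟨.nil, by simp, by simp, by simpa using h.ne⟩
    have := Finset.card_pos.2 ⟨v, this⟩
    simp only [mbN]
    exact_mod_cast this
  | succ i ih =>
    intro u v h
    have hsub : ((G.neighborFinset v).erase u).biUnion (fun x => mbT G i v x) ⊆ mbT G (i+1) u v := by
      intro w hw
      simp only [Finset.mem_biUnion, Finset.mem_erase, SimpleGraph.mem_neighborFinset] at hw
      obtain ⟨x, ⟨hxu, hvx⟩, hw⟩ := hw
      rw [mb_mem_T] at hw ⊢
      obtain ⟨p, hp, hpl, hv⟩ := hw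
      refine ⟨.cons hvx p, (SimpleGraph.Walk.cons_isPath_iff _ _).2 ⟨hp, hv⟩, by simp [hpl], ?_⟩
      rw [SimpleGraph.Walk.support_cons, List.mem_cons, not_or]
      refine ⟨h.ne, fun hu => ?_⟩
      have h1 := SimpleGraph.Walk.length_takeUntil_le_length p hu
      have := mb_unique hg (.cons hvx (p.takeUntil u hu)) (.cons h.symm .nil)
        ((SimpleGraph.Walk.cons_isPath_iff _ _).2 ⟨hp.takeUntil hu, fun hh => hv
          (SimpleGraph.Walk.support_takeUntil_subset_support _ _ hh)⟩)
        (by simp [h.ne.symm]) (by simp; omega)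
      have := congrArg SimpleGraph.Walk.length this
      simp only [SimpleGraph.Walk.length_cons, SimpleGraph.Walk.length_nil] at this
      exact hxu (SimpleGraph.Walk.eq_of_length_eq_zero (p := p.takeUntil u hu) (by omega))
    have hdis : ((G.neighborFinset v).erase u : Set V).PairwiseDisjoint (fun x => mbT G i v x) := by
      intro x hx y hy hxy
      simp only [Finset.coe_erase, Set.mem_sdiff, Finset.mem_coe, SimpleGraph.mem_neighborFinset] at hx hy
      rw [Function.onFun, Finset.disjoint_left]
      intro w hw hw'
      rw [mb_mem_T] at hw hw'
      obtain ⟨p, hp, hpl, hv⟩ := hw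
      obtain ⟨q, hq, hql, hv'⟩ := hw'
      have := mb_unique hg (.cons hx.1 p) (.cons hy.1 q)
        ((SimpleGraph.Walk.cons_isPath_iff _ _).2 ⟨hp, hv⟩)
        ((SimpleGraph.Walk.cons_isPath_iff _ _).2 ⟨hq, hv'⟩) (by simp; omega)
      rw [SimpleGraph.Walk.cons.injEq] at this
      exact hxy this.1
    have hc := Finset.card_le_card hsub
    rw [Finset.card_biUnion (by simpa using hdis)] at hc
    calc mbN G (i+1) u v ≤ ∑ x ∈ (G.neighborFinset v).erase u, ((mbT G i v x).card : ℝ) := by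
          simp only [mbN]
          refine Finset.sum_le_sum fun x hx => ih (by omega) _ _ ?_
          simpa using (Finset.mem_erase.1 hx).2
      _ ≤ _ := by exact_mod_cast hc

lemma mb_edge {V : Type*} [Fintype V] [DecidableEq V]
    (G : SimpleGraph V) [DecidableRel G.Adj] (r : ℕ) (hg : MBGirth G r) (u v : V) (h : G.Adj u v) :
    ∑ i ∈ Finset.range r, (mbN G i u v + mbN G i v u) ≤ Fintype.card V := by
  have h1 : ∀ u v, ((Finset.range r : Finset ℕ) : Set ℕ).PairwiseDisjoint (fun i => mbT G i u v) := by
    intro u v i hi j hj hij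
    rw [Function.onFun, Finset.disjoint_left]
    intro w hw hw'
    rw [mb_mem_T] at hw hw'
    obtain ⟨p, hp, hpl, hv⟩ := hw
    obtain ⟨q, hq, hql, hv'⟩ := hw'
    simp at hi hj
    have := mb_unique hg p q hp hq (by omega)
    subst this
    omega
  have h2 : Disjoint ((Finset.range r).biUnion fun i => mbT G i u v)
      ((Finset.range r).biUnion fun i => mbT G i v u) := by
    rw [Finset.disjoint_left]
    intro w hw hw'
    simp only [Finset.mem_biUnion, Finset.mem_range] at hw hw'
    obtain ⟨i, hi, hw⟩ := hw
    obtain ⟨j, hj, hw'⟩ := hw'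
    rw [mb_mem_T] at hw hw'
    obtain ⟨p, hp, hpl, hv⟩ := hw
    obtain ⟨q, hq, hql, hv'⟩ := hw'
    have := mb_unique hg (.cons h p) q ((SimpleGraph.Walk.cons_isPath_iff _ _).2 ⟨hp, hv⟩) hq
      (by simp; omega)
    apply hv'
    rw [← this]
    simp
  have h3 := Finset.card_le_univ (((Finset.range r).biUnion fun i => mbT G i u v) ∪
      ((Finset.range r).biUnion fun i => mbT G i v u))
  rw [Finset.card_union_of_disjoint h2, Finset.card_biUnion (h1 u v), Finset.card_biUnion (h1 v u),
    ← Finset.sum_add_distrib] at h3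
  calc _ ≤ ∑ i ∈ Finset.range r, (((mbT G i u v).card : ℝ) + (mbT G i v u).card) := by
        refine Finset.sum_le_sum fun i hi => ?_
        exact add_le_add (mb_N_le G r hg i (by simpa using hi) _ _ h)
          (mb_N_le G r hg i (by simpa using hi) _ _ h.symm)
    _ ≤ _ := by exact_mod_cast h3

lemma mb_swap {V : Type*} [Fintype V] [DecidableEq V]
    (G : SimpleGraph V) [DecidableRel G.Adj] (f : V → V → ℝ) :
    ∑ u, ∑ v ∈ G.neighborFinset u, f u v = ∑ v, ∑ u ∈ G.neighborFinset v, f u v := by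
  apply Finset.sum_comm'
  intro x y
  simp [G.adj_comm]

lemma mb_N_pos {V : Type*} [Fintype V] [DecidableEq V]
    (G : SimpleGraph V) [DecidableRel G.Adj] (hd : ∀ v, 2 ≤ G.degree v) (i : ℕ) :
    ∀ u v : V, 0 < mbN G i u v := by
  induction i with
  | zero => intro u v; simp [mbN]
  | succ i ih =>
    intro u v
    simp only [mbN]
    refine Finset.sum_pos (fun x _ => ih _ _) ?_
    rw [← Finset.card_pos]
    have := Finset.pred_card_le_card_erase (s := G.neighborFinset v) (a := u)
    have h2 := hd v
    rw [SimpleGraph.card_neighborFinset_eq_degree] at this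
    omega

lemma mb_jensen {ι : Type*} (s : Finset ι) (hs : s.Nonempty) (f : ι → ℝ) (hf : ∀ x, 0 < f x) :
    Real.log s.card + (1 / (s.card : ℝ)) * ∑ x ∈ s, Real.log (f x) ≤ Real.log (∑ x ∈ s, f x) := by
  have hk : (0:ℝ) < s.card := by exact_mod_cast Finset.card_pos.2 hs
  have hS : 0 < ∑ x ∈ s, f x := Finset.sum_pos (fun x _ => hf x) hs
  set S := ∑ x ∈ s, f x with hSd
  have key : ∀ x ∈ s, Real.log (f x) ≤ (Real.log S - Real.log s.card - 1) + f x * (s.card / S) := by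
    intro x _
    have := Real.log_le_sub_one_of_pos (x := f x * (s.card / S)) (mul_pos (hf x) (div_pos hk hS))
    rw [Real.log_mul (hf x).ne' (div_pos hk hS).ne', Real.log_div hk.ne' hS.ne'] at this
    linarith
  have := Finset.sum_le_sum key
  rw [Finset.sum_add_distrib, Finset.sum_const, ← Finset.sum_mul, ← hSd, nsmul_eq_mul,
    mul_div_cancel₀ _ hS.ne'] at this
  have h2 : (1 / (s.card : ℝ)) * ∑ x ∈ s, Real.log (f x) ≤ (1 / (s.card : ℝ)) *
     (s.card * (Real.log S - Real.log s.card - 1) + s.card) := by gcongr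
  have h3 : (1 / (s.card : ℝ)) *
     (s.card * (Real.log S - Real.log s.card - 1) + s.card) = Real.log S - Real.log s.card := by
    field_simp; ring
  linarith

lemma mb_log {V : Type*} [Fintype V] [DecidableEq V]
    (G : SimpleGraph V) [DecidableRel G.Adj] (hd : ∀ v, 2 ≤ G.degree v) (i : ℕ) :
    i * ∑ v, (G.degree v : ℝ) * Real.log (G.degree v - 1) ≤
      ∑ u, ∑ v ∈ G.neighborFinset u, Real.log (mbN G i u v) := by
  induction i with
  | zero => simp [mbN]
  | succ i ih =>
    have h1 : ∀ u, ∀ v ∈ G.neighborFinset u, Real.log (G.degree v - 1) + (1 / ((G.degree v : ℝ) - 1)) *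
        ∑ x ∈ (G.neighborFinset v).erase u, Real.log (mbN G i v x) ≤
          Real.log (mbN G (i+1) u v) := by
      intro u v hv
      have hu : u ∈ G.neighborFinset v := by
        rw [SimpleGraph.mem_neighborFinset] at hv ⊢; exact hv.symm
      have hc : (((G.neighborFinset v).erase u).card : ℝ) = G.degree v - 1 := by
        rw [Finset.card_erase_of_mem hu, SimpleGraph.card_neighborFinset_eq_degree,
          Nat.cast_sub (by have := hd v; omega)]
        simp
      have := mb_jensen ((G.neighborFinset v).erase u) (by
        rw [← Finset.card_pos, Finset.card_erase_of_mem hu,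
          SimpleGraph.card_neighborFinset_eq_degree]
        have := hd v; omega) (fun x => mbN G i v x) (fun x => mb_N_pos G hd i v x)
      rw [hc] at this
      exact this
    have h2 := Finset.sum_le_sum fun u (_ : u ∈ Finset.univ) => Finset.sum_le_sum (h1 u)
    rw [mb_swap] at h2
    refine le_trans ?_ h2
    rw [Nat.cast_succ, add_mul, one_mul, add_comm]
    simp only [Finset.sum_add_distrib]
    refine add_le_add ?_ (ih.trans ?_)
    · simp
    · refine Finset.sum_le_sum fun v _ => ?_
      rw [← Finset.mul_sum]
      have : ∑ u ∈ G.neighborFinset v, ∑ x ∈ (G.neighborFinset v).erase u, Real.log (mbN G i v x)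
        = (G.degree v - 1) * ∑ x ∈ G.neighborFinset v, Real.log (mbN G i v x) := by
        rw [Finset.sum_congr rfl fun u hu => Finset.sum_erase_eq_sub hu]
        rw [Finset.sum_sub_distrib, Finset.sum_const, SimpleGraph.card_neighborFinset_eq_degree,
          nsmul_eq_mul]
        ring
      rw [this]
      have h : (0:ℝ) < G.degree v - 1 := by
        have : (2:ℝ) ≤ G.degree v := by exact_mod_cast hd v
        linarith
      rw [← mul_assoc, one_div, inv_mul_cancel₀ h.ne', one_mul]

lemma mb_tangent (b x : ℝ) (hb : 1 ≤ b) (hx : 1 ≤ x) :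
    (1 + 1 / b) * (x - b) ≤ (x + 1) * (Real.log x - Real.log b) := by
  have hb0 : 0 < b := by linarith
  have hx0 : 0 < x := by linarith
  rcases le_total b x with h | h
  · have := Real.le_log_one_add_of_nonneg (x := x / b - 1) (by
      rw [sub_nonneg, le_div_iff₀ hb0]; linarith)
    rw [add_sub_cancel, Real.log_div hx0.ne' hb0.ne'] at this
    have h2 : 2 * (x / b - 1) / (x / b - 1 + 2) = 2 * (x - b) / (x + b) := by
      field_simp; ring
    rw [h2] at this
    refine le_trans ?_ (mul_le_mul_of_nonneg_left this (by linarith))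
    have : (1 + 1 / b) * (x - b) = (b + 1) * (x - b) / b := by field_simp
    rw [this, mul_div_assoc', div_le_div_iff₀ hb0 (by linarith)]
    have : 0 ≤ (x - b) * ((b - 1) * (x - b)) := by
      apply mul_nonneg (by linarith) (mul_nonneg (by linarith) (by linarith))
    nlinarith
  · have h1 : Real.log (b / x) ≤ (b / x - (b / x)⁻¹) / 2 := by
      rw [← Real.sinh_log (div_pos hb0 hx0), Real.self_le_sinh_iff]
      apply Real.log_nonneg
      rw [le_div_iff₀ hx0]; linarith
    rw [Real.log_div hb0.ne' hx0.ne'] at h1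
    have h2 : (x + 1) * (Real.log b - Real.log x) ≤ (x + 1) * ((b / x - (b / x)⁻¹) / 2) :=
      mul_le_mul_of_nonneg_left h1 (by linarith)
    have h3 : (x + 1) * ((b / x - (b / x)⁻¹) / 2) ≤ (1 + 1 / b) * (b - x) := by
      have e1 : (x + 1) * ((b / x - (b / x)⁻¹) / 2) = (x + 1) * ((b - x) * (b + x)) / (2 * b * x) := by
        field_simp; ring
      have e2 : (1 + 1 / b) * (b - x) = (b + 1) * (b - x) / b := by field_simp
      rw [e1, e2, div_le_div_iff₀ (by positivity) hb0]
      have : 0 ≤ b * (b - x) * ((x - 1) * (b - x)) := by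
        apply mul_nonneg (mul_nonneg hb0.le (by linarith)) (mul_nonneg (by linarith) (by linarith))
      nlinarith
    linarith

lemma mb_core {V : Type*} [Fintype V] [DecidableEq V]
    (G : SimpleGraph V) [DecidableRel G.Adj] (r : ℕ) (hg : MBGirth G r)
    (hd : ∀ v, 2 ≤ G.degree v) (a : ℝ) (ha2 : 2 ≤ a) (hV : 0 < Fintype.card V)
    (ha : ∑ v, (G.degree v : ℝ) = a * Fintype.card V) :
    2 * ∑ i ∈ Finset.range r, (a - 1) ^ i ≤ (Fintype.card V : ℝ) := by
  have hV' : (0:ℝ) < Fintype.card V := by exact_mod_cast hV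
  set M : ℝ := ∑ v, (G.degree v : ℝ) with hM
  have hMpos : 0 < M := by rw [ha]; positivity
  have hconst : ∀ c : ℝ, ∑ u, ∑ v ∈ G.neighborFinset u, c = M * c := by
    intro c
    simp [hM, Finset.sum_mul]
  have hb : 0 < a - 1 := by linarith
  have hlog : M * Real.log (a - 1) ≤ ∑ v, (G.degree v : ℝ) * Real.log (G.degree v - 1) := by
    have : ∀ v ∈ (Finset.univ : Finset V), (1 + 1 / (a - 1)) * (G.degree v - a) ≤
        (G.degree v : ℝ) * Real.log (G.degree v - 1) - G.degree v * Real.log (a - 1) := by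
      intro v _
      have h2 : (2:ℝ) ≤ G.degree v := by exact_mod_cast hd v
      have := mb_tangent (a - 1) (G.degree v - 1) (by linarith) (by linarith)
      have e : (G.degree v : ℝ) - 1 - (a - 1) = G.degree v - a := by ring
      rw [e, sub_add_cancel] at this
      linarith
    have := Finset.sum_le_sum this
    rw [← Finset.mul_sum, Finset.sum_sub_distrib, Finset.sum_sub_distrib, ← hM, ← Finset.sum_mul,
      ← hM, Finset.sum_const, Finset.card_univ, nsmul_eq_mul, ha] at this
    rw [ha]
    nlinarith
  have hN : ∀ i, M * (a - 1) ^ i ≤ ∑ u, ∑ v ∈ G.neighborFinset u, mbN G i u v := by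
    intro i
    have hc : 0 < (a - 1) ^ i := by positivity
    have h1 : ∀ u, ∀ v ∈ G.neighborFinset u, (a - 1) ^ i * Real.log (mbN G i u v)
        + (a - 1) ^ i * (1 - i * Real.log (a - 1)) ≤ mbN G i u v := by
      intro u v _
      have hp := mb_N_pos G hd i u v
      have := Real.log_le_sub_one_of_pos (div_pos hp hc)
      rw [Real.log_div hp.ne' hc.ne', Real.log_pow] at this
      have := mul_le_mul_of_nonneg_left this hc.le
      rw [mul_sub, mul_sub _ (_ / _), mul_div_cancel₀ _ hc.ne'] at this
      linarith
    have h2 := Finset.sum_le_sum fun u (_ : u ∈ Finset.univ) => Finset.sum_le_sum (h1 u)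
    refine le_trans ?_ h2
    simp only [Finset.sum_add_distrib, ← Finset.mul_sum]
    rw [hconst]
    have h3 := mb_log G hd i
    have h4 : (i : ℝ) * (M * Real.log (a - 1)) ≤
      i * ∑ v, (G.degree v : ℝ) * Real.log (G.degree v - 1) := by gcongr
    have := mul_le_mul_of_nonneg_left (h4.trans h3) hc.le
    linarith
  have h1 : ∑ u, ∑ v ∈ G.neighborFinset u, ∑ i ∈ Finset.range r, (mbN G i u v + mbN G i v u)
      ≤ M * Fintype.card V := by
    rw [← hconst]
    refine Finset.sum_le_sum fun u _ => Finset.sum_le_sum fun v hv => ?_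
    exact mb_edge G r hg u v (by simpa using hv)
  have h2 : ∑ u, ∑ v ∈ G.neighborFinset u, ∑ i ∈ Finset.range r, (mbN G i u v + mbN G i v u)
      = ∑ i ∈ Finset.range r, 2 * ∑ u, ∑ v ∈ G.neighborFinset u, mbN G i u v := by
    simp_rw [Finset.sum_comm (t := Finset.range r)]
    refine Finset.sum_congr rfl fun i _ => ?_
    simp only [Finset.sum_add_distrib]
    rw [mb_swap G (fun u v => mbN G i v u)]
    ring
  have h3 : ∑ i ∈ Finset.range r, 2 * (M * (a - 1) ^ i) ≤ M * Fintype.card V := by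
    rw [h2] at h1
    refine le_trans (Finset.sum_le_sum fun i _ => ?_) h1
    linarith [hN i]
  rw [← Finset.mul_sum, ← Finset.mul_sum] at h3
  refine le_of_mul_le_mul_left ?_ hMpos
  linarith

lemma mb_induct (r k : ℕ) : ∀ {V : Type*} [Fintype V] [DecidableEq V]
    (G : SimpleGraph V) [DecidableRel G.Adj], MBGirth G r → Fintype.card V = k → 0 < k →
    Fintype.card V ≤ G.edgeFinset.card →
    2 * ∑ i ∈ Finset.range r, ((2 * G.edgeFinset.card / Fintype.card V : ℝ) - 1) ^ i
      ≤ (Fintype.card V : ℝ) := by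
  induction k with
  | zero => intro V _ _ G _ _ _ h; omega
  | succ k ih =>
    intro V _ _ G _ hg hk _ hm
    have hV : 0 < Fintype.card V := by omega
    have hV' : (0:ℝ) < Fintype.card V := by exact_mod_cast hV
    have hm' : (Fintype.card V : ℝ) ≤ G.edgeFinset.card := by exact_mod_cast hm
    by_cases hd : ∀ v, 2 ≤ G.degree v
    · refine mb_core G r hg hd _ ?_ hV ?_
      · rw [le_div_iff₀ hV']; linarith
      · rw [div_mul_cancel₀ _ hV'.ne']
        exact_mod_cast G.sum_degrees_eq_twice_card_edges
    · push Not at hd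
      obtain ⟨v, hv⟩ := hd
      have hE : (G.induce {v}ᶜ).edgeFinset.card = G.edgeFinset.card - G.degree v := by
        rw [SimpleGraph.card_edgeFinset_induce_compl_singleton,
          SimpleGraph.card_edgeFinset_deleteIncidenceSet]
      have hC : Fintype.card ({v}ᶜ : Set V) = k := by
        rw [Fintype.card_compl_set, hk]; simp
      have hk0 : 0 < k := by
        rcases Nat.eq_zero_or_pos k with h | h
        · subst h
          have h1 := G.card_edgeFinset_le_card_choose_two
          rw [hk] at h1
          have h2 : (0 + 1).choose 2 = 0 := by decide
          omega
        · exact h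
      have hg' : MBGirth (G.induce ({v}ᶜ : Set V)) r := by
        intro x w hw
        have := hg _ _ (hw.map (f := (SimpleGraph.Embedding.induce ({v}ᶜ : Set V)).toHom)
          (SimpleGraph.Embedding.induce (G := G) ({v}ᶜ : Set V)).injective)
        rwa [SimpleGraph.Walk.length_map] at this
      have := ih (G.induce ({v}ᶜ : Set V)) hg' hC hk0 (by rw [hC, hE]; omega)
      rw [hC, hE] at this
      rw [hk] at hm' ⊢
      have hk0' : (0:ℝ) < k := by exact_mod_cast hk0
      have hle : (2 * G.edgeFinset.card / ((k + 1 : ℕ) : ℝ) : ℝ) ≤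
          2 * ((G.edgeFinset.card - G.degree v : ℕ) : ℝ) / k := by
        have h1 : (G.edgeFinset.card : ℝ) - 1 ≤ ((G.edgeFinset.card - G.degree v : ℕ) : ℝ) := by
          rw [Nat.cast_sub (by omega)]
          have : (G.degree v : ℝ) ≤ 1 := by exact_mod_cast (by omega)
          linarith
        rw [div_le_div_iff₀ (by positivity) hk0']
        push_cast at hm' ⊢
        nlinarith
      have h0 : (0:ℝ) ≤ (2 * G.edgeFinset.card / ((k + 1 : ℕ) : ℝ) : ℝ) - 1 := by
        rw [sub_nonneg, le_div_iff₀ (by positivity)]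
        have : (0:ℝ) < ((k+1 : ℕ) : ℝ) := by positivity
        linarith
      calc _ ≤ 2 * ∑ i ∈ Finset.range r,
            (2 * ((G.edgeFinset.card - G.degree v : ℕ) : ℝ) / k - 1) ^ i := by
            gcongr
        _ ≤ k := this
        _ ≤ _ := by push_cast; linarith

/-- (Irregular Moore bound, even-girth case.)  If `G` has `n`
vertices, `m` edges, average degree `a = 2m/n ≥ 2` and girth greater than `2r`,
then `n ≥ 2 ∑_{i=0}^{r-1} (a - 1)^i`. -/
theorem moore_bound_even {V : Type*} [Fintype V] [DecidableEq V]
    (G : SimpleGraph V) [DecidableRel G.Adj] (n m r : ℕ) (hr : 1 ≤ r)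
    (hn : n = Fintype.card V) (hm : m = G.edgeFinset.card)
    (a : ℝ) (ha : a = 2 * m / n) (ha2 : 2 ≤ a)
    (hg : ((2 * r : ℕ) : ℕ∞) < G.girth) :
    2 * ∑ i ∈ Finset.range r, (a - 1) ^ i ≤ (n : ℝ) := by
  have hn0 : (0:ℝ) < n := by
    rcases Nat.eq_zero_or_pos n with h | h
    · rw [h] at ha
      simp at ha
      linarith
    · exact_mod_cast h
  have hnm : (n : ℝ) ≤ m := by
    rw [ha, le_div_iff₀ hn0] at ha2
    linarith
  have hG : MBGirth G r := by
    intro v w hw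
    have h1 := SimpleGraph.girth_le_length hw
    have h2 : 2 * r < G.girth := by exact_mod_cast hg
    omega
  rw [ha]
  subst hn hm
  exact mb_induct r _ G hG rfl (by exact_mod_cast hn0) (by exact_mod_cast hnm)
end
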